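/- arXiv:1705.10925 — 5 statements merged into one kernel-verified Lean document; each statement's English description precedes it below -/
import Mathlib

section
/- Let x : V → V → ℝ be any edge-weight function with x i j = 0 whenever (i,j) ∉ E, let y : V → ℝ be any vertex-weight function, let H be the associated Schrödinger matrix on G and H̄ its lift to the spanning tree graph, and let m' be the integer-valued function on strongly connected subsets of V defined by m'(V) = 1 and m'(W) = k(W) − ∑_{W' strongly connected, W ⊊ W' ⊆ V} m'(W') for strongly connected W ⊊ V. Then det H̄ · ∏_W det(H|_W)^{(−m'(W))₊} = ∏_W det(H|_W)^{(m'(W))₊}, where both products range over all strongly connected subsets W ⊆ V (including W = V, for which H|_V = H and m'(V) = 1). (Equivalently, det H̄ = ∏_{W strongly connected ⊆ V} det(H|_W)^{m'(W)}.) -/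
open Matrix Finset Classical

noncomputable section

/-- A directed rooted spanning tree of the graph with edge set `E`, rooted at `r`,
encoded as the "parent" function `t`. -/
def IsSpanningTree {V : Type*} (E : Set (V × V)) (r : V) (t : V → V) : Prop :=
  t r = r ∧ (∀ v, v ≠ r → (v, t v) ∈ E) ∧ ∀ v, ∃ n, t^[n] v = r

/-- The set `V̄` of all spanning trees of the graph, over all roots, as a type:
a pair of the parent function and the root. -/
abbrev STree {V : Type*} (E : Set (V × V)) : Type _ :=
  {p : (V → V) × V // IsSpanningTree E p.2 p.1}

def STree.tree {V : Type*} {E : Set (V × V)} (t : STree E) : V → V := t.1.1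

def STree.root {V : Type*} {E : Set (V × V)} (t : STree E) : V := t.1.2

noncomputable instance STree.instFintype {V : Type*} [Finite V] {E : Set (V × V)} :
    Fintype (STree E) := Fintype.ofFinite _

/-- The edge relation of the spanning tree graph `Ḡ`. -/
def STreeEdge {V : Type*} [DecidableEq V] (E : Set (V × V)) (t t' : STree E) : Prop :=
  t.root ≠ t'.root ∧ (t.root, t'.root) ∈ E ∧
    t'.tree = Function.update (Function.update t.tree t.root t'.root) t'.root t'.root

/-- The edge set of the spanning tree graph `Ḡ`. -/
def liftEdges {V : Type*} [DecidableEq V] (E : Set (V × V)) : Set (STree E × STree E) :=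
  {p | STreeEdge E p.1 p.2}

/-- The graph `(V, E)` is strongly connected. -/
def StronglyConnected {V : Type*} (E : Set (V × V)) : Prop :=
  ∀ u v : V, Relation.ReflTransGen (fun a b => (a, b) ∈ E) u v

/-- `W` is a (nonempty) strongly connected subset of the vertices: any two vertices of `W`
are joined by a directed path staying inside `W`. -/
def StronglyConnectedSub {V : Type*} (E : Set (V × V)) (W : Finset V) : Prop :=
  W.Nonempty ∧ ∀ u ∈ W, ∀ v ∈ W,
    Relation.ReflTransGen (fun a b => a ∈ W ∧ b ∈ W ∧ (a, b) ∈ E) u v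

/-- `P` is a transition matrix associated with the graph `(V, E)`. -/
def IsTransMatrix {V : Type*} [Fintype V] (E : Set (V × V)) (P : Matrix V V ℝ) : Prop :=
  (∀ i j, 0 ≤ P i j) ∧ (∀ i, ∑ j, P i j = 1) ∧ ∀ i j, i ≠ j → (0 < P i j ↔ (i, j) ∈ E)

/-- The lift `P̄` of the matrix `P` to the spanning tree graph. -/
def liftP {V : Type*} [DecidableEq V] (E : Set (V × V)) (P : Matrix V V ℝ) :
    Matrix (STree E) (STree E) ℝ :=
  fun t t' => if t = t' then P t.root t.root
    else if STreeEdge E t t' then P t.root t'.root else 0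

/-- A directed rooted spanning forest of the graph with edge set `E`, rooted in `W`. -/
def IsSpanningForest {V : Type*} (E : Set (V × V)) (W : Finset V) (f : V → V) : Prop :=
  (∀ w ∈ W, f w = w) ∧ (∀ v, v ∉ W → (v, f v) ∈ E) ∧ ∀ v, ∃ n, f^[n] v ∈ W

/-- `k(W)`: the number of spanning forests rooted in `W`. -/
def kForest {V : Type*} (E : Set (V × V)) (W : Finset V) : ℕ :=
  Nat.card {f : V → V // IsSpanningForest E W f}

/-- The `W × W` submatrix of `A` (rows and columns indexed by `W`). -/
def subm {V : Type*} {R : Type*} (A : Matrix V V R) (W : Finset V) : Matrix W W R :=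
  A.submatrix (fun i => (i : V)) (fun j => (j : V))

/-- `Ψ_W`: the sum of the weights of the spanning forests rooted in `W`,
for edge weights `x`. -/
def forestWeightSum {V : Type*} [Fintype V] [DecidableEq V] (E : Set (V × V))
    (x : V → V → ℝ) (W : Finset V) : ℝ :=
  ∑ f ∈ Finset.univ.filter (IsSpanningForest E W),
    ∏ v ∈ Finset.univ.filter (fun v => v ∉ W), x v (f v)

/-- The weight of a spanning tree: product of edge weights over non-root vertices. -/
def treeWeight {V : Type*} [Fintype V] [DecidableEq V] {E : Set (V × V)}
    (x : V → V → ℝ) (t : STree E) : ℝ :=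
  ∏ v ∈ Finset.univ.erase t.root, x v (t.tree v)

/-- `step(t, j)`: move the root of the (rooted function) `p` along the edge to `j`. -/
def stepF {V : Type*} [DecidableEq V] (E : Set (V × V)) (p : (V → V) × V) (j : V) :
    (V → V) × V :=
  if j = p.2 then p
  else if (p.2, j) ∈ E then (Function.update (Function.update p.1 p.2 j) j j, j)
  else p

/-- `traverse(c, p)`: successively apply `step` with the vertices `c 1, c 2, …, c (n-1), c 0`. -/
def traverse {V : Type*} [DecidableEq V] (E : Set (V × V)) (n : ℕ) (c : ZMod n → V)
    (p : (V → V) × V) : (V → V) × V :=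
  (List.range n).foldl (fun q i => stepF E q (c ((i : ZMod n) + 1))) p

/-- The Schrödinger matrix `H = Q + Y` on `G`, for edge weights `x` and vertex weights `y`. -/
def schrodinger {V : Type*} [Fintype V] [DecidableEq V] (x : V → V → ℝ) (y : V → ℝ) :
    Matrix V V ℝ :=
  fun i j => if i = j then y i + ∑ k ∈ Finset.univ.erase i, x i k else -x i j

/-- The lift `H̄` of the Schrödinger matrix `H` to the spanning tree graph. -/
def schrodingerLift {V : Type*} [Fintype V] [DecidableEq V] (E : Set (V × V))
    (x : V → V → ℝ) (y : V → ℝ) : Matrix (STree E) (STree E) ℝ :=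
  fun t t' =>
    if t = t' then y t.root + ∑ j ∈ Finset.univ.erase t.root, x t.root j
    else if STreeEdge E t t' then -x t.root t'.root else 0

open Matrix Finset Classical Polynomial in
lemma det_aeval_eq {n : Type*} [Fintype n] [DecidableEq n] (A : Matrix n n ℂ) (p : ℂ[X]) :
    (aeval A p).det = (A.charpoly.roots.map (fun l => p.eval l)).prod := by
  have hcard : A.charpoly.roots.card = Fintype.card n := by
    rw [← (IsAlgClosed.splits A.charpoly).natDegree_eq_card_roots, charpoly_natDegree_eq_dim]
  have hC : ∀ c : ℂ, (aeval A (C c)).det = (A.charpoly.roots.map (fun l => (C c).eval l)).prod := by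
    intro c
    simp [Matrix.algebraMap_eq_diagonal, hcard]
  have hX : ∀ c : ℂ, (aeval A (X - C c)).det
      = (A.charpoly.roots.map (fun l => (X - C c).eval l)).prod := by
    intro c
    have h1 : (aeval A (X - C c)) = - (Matrix.scalar n c - A) := by
      simp [Matrix.algebraMap_eq_diagonal]
    have h2 : A.charpoly.eval c = (A.charpoly.roots.map (fun l => c - l)).prod := by
      conv_lhs => rw [(IsAlgClosed.splits A.charpoly).eq_prod_roots]
      simp [A.charpoly_monic.leadingCoeff, eval_multiset_prod]
    rw [h1, Matrix.det_neg, ← Matrix.eval_charpoly, h2, ← hcard]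
    have h3 := Multiset.prod_map_neg (A.charpoly.roots.map (fun l => c - l))
    rw [Multiset.card_map] at h3
    rw [← h3]
    simp
  let φ : ℂ[X] →* ℂ := (Matrix.detMonoidHom).comp ((aeval A : ℂ[X] →ₐ[ℂ] Matrix n n ℂ) : ℂ[X] →* Matrix n n ℂ)
  let ψ : ℂ[X] →* ℂ :=
    { toFun := fun p => (A.charpoly.roots.map (fun l => p.eval l)).prod
      map_one' := by simp
      map_mul' := by intro p q; simp [Multiset.prod_map_mul] }
  change φ p = ψ p
  rw [(IsAlgClosed.splits p).eq_prod_roots, map_mul, map_mul, map_multiset_prod, map_multiset_prod]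
  congr 1
  · exact hC _
  · rw [Multiset.map_map, Multiset.map_map]
    congr 1
    apply Multiset.map_congr rfl
    intro c _
    exact hX c

open Matrix Finset Classical Polynomial in
lemma trace_pow_eq {n : Type*} [Fintype n] [DecidableEq n] (A : Matrix n n ℂ) (k : ℕ) :
    (A ^ k).trace = (A.charpoly.roots.map (fun l => l ^ k)).sum := by
  have h : (A ^ k).charpoly = ((A.charpoly.roots.map (fun l => l ^ k)).map (fun a => X - C a)).prod := by
    apply Polynomial.funext
    intro z
    rw [Matrix.eval_charpoly, eval_multiset_prod]
    have h1 : (Matrix.scalar n z - A ^ k) = aeval A (C z - X ^ k) := by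
      simp [Matrix.algebraMap_eq_diagonal]
    rw [h1, det_aeval_eq]
    simp
  rw [trace_eq_sum_roots_charpoly, h, roots_multiset_prod_X_sub_C]

open Polynomial in
lemma multiset_eq_of_powsum (s t : Multiset ℂ)
    (h : ∀ k : ℕ, (s.map (fun l => l ^ k)).sum = (t.map (fun l => l ^ k)).sum) : s = t := by
  classical
  have hp : ∀ p : ℂ[X], (s.map (fun l => p.eval l)).sum = (t.map (fun l => p.eval l)).sum := by
    intro p
    induction p using Polynomial.induction_on' with
    | add p q hp hq => simp [Multiset.sum_map_add, hp, hq]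
    | monomial n a => simp [Multiset.sum_map_mul_left, h]
  have key : ∀ (u : Multiset ℂ) (a : ℂ) (p : ℂ[X]), (∀ b ∈ u, b ≠ a → p.eval b = 0) →
      (u.map (fun l => p.eval l)).sum = u.count a * p.eval a := by
    intro u a p
    induction u using Multiset.induction_on with
    | empty => simp
    | cons b u ih =>
      intro hb
      rw [Multiset.map_cons, Multiset.sum_cons, ih (fun c hc => hb c (Multiset.mem_cons_of_mem hc)),
        Multiset.count_cons]
      by_cases hab : b = a
      · subst hab; simp; ring
      · rw [hb b (Multiset.mem_cons_self _ _) hab]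
        simp [Ne.symm hab]
  ext a
  let p : ℂ[X] := ∏ b ∈ (s + t).toFinset.erase a, (X - C b)
  have hz : ∀ b ∈ s + t, b ≠ a → p.eval b = 0 := by
    intro b hb hba
    simp only [p, eval_prod]
    apply Finset.prod_eq_zero (i := b)
    · simp only [Finset.mem_erase, Multiset.mem_toFinset]; exact ⟨hba, hb⟩
    · simp
  have hne : p.eval a ≠ 0 := by
    simp only [p, eval_prod]
    apply Finset.prod_ne_zero_iff.2
    intro b hb
    simp [sub_ne_zero, (Finset.ne_of_mem_erase hb).symm]
  have := hp p
  rw [key s a p (fun b hb => hz b (Multiset.mem_add.2 (Or.inl hb))),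
    key t a p (fun b hb => hz b (Multiset.mem_add.2 (Or.inr hb)))] at this
  exact_mod_cast mul_right_cancel₀ hne this

lemma det_of_traces {n ι : Type*} [Fintype n] [DecidableEq n] {T : ι → Type*}
    [∀ i, Fintype (T i)] [∀ i, DecidableEq (T i)] (s : Finset ι)
    (N : Matrix n n ℝ) (M : ∀ i, Matrix (T i) (T i) ℝ) (a b : ι → ℕ)
    (h : ∀ k : ℕ, (N ^ k).trace + ∑ i ∈ s, (a i : ℝ) * (M i ^ k).trace
      = ∑ i ∈ s, (b i : ℝ) * (M i ^ k).trace) :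
    N.det * ∏ i ∈ s, (M i).det ^ a i = ∏ i ∈ s, (M i).det ^ b i := by
  classical
  let N' := N.map Complex.ofRealHom
  let M' := fun i => (M i).map Complex.ofRealHom
  have tr : ∀ {m : Type _} [Fintype m] [DecidableEq m] (A : Matrix m m ℝ) (k : ℕ),
      ((A.map Complex.ofRealHom) ^ k).trace = (((A ^ k).trace : ℝ) : ℂ) := by
    intro m _ _ A k
    rw [← Matrix.map_pow]
    simp [Matrix.trace]
  have tr2 : ∀ {m : Type _} [Fintype m] [DecidableEq m] (A : Matrix m m ℝ) (k : ℕ),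
      ((A.map Complex.ofRealHom) ^ k).trace = (((A ^ k).trace : ℝ) : ℂ) := by
    intro m _ _ A k
    rw [← Matrix.map_pow]
    simp [Matrix.trace]
  have hm : N'.charpoly.roots + ∑ i ∈ s, a i • (M' i).charpoly.roots
      = ∑ i ∈ s, b i • (M' i).charpoly.roots := by
    apply multiset_eq_of_powsum
    intro k
    let F : Multiset ℂ →+ ℂ := Multiset.sumAddMonoidHom.comp (Multiset.mapAddMonoidHom (fun l : ℂ => l ^ k))
    change F _ = F _
    rw [map_add, map_sum, map_sum]
    simp only [map_nsmul, nsmul_eq_mul]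
    have h1 : F N'.charpoly.roots = (((N ^ k).trace : ℝ) : ℂ) := by
      rw [← tr]; exact (trace_pow_eq _ _).symm
    have h2 : ∀ i, F (M' i).charpoly.roots = (((M i ^ k).trace : ℝ) : ℂ) := by
      intro i
      rw [← tr2]; exact (trace_pow_eq _ _).symm
    simp only [h1, h2]
    exact_mod_cast h k
  have hp := congrArg Multiset.prod hm
  rw [Multiset.prod_add, Multiset.prod_sum, Multiset.prod_sum] at hp
  simp only [Multiset.prod_nsmul, ← Matrix.det_eq_prod_roots_charpoly] at hp
  have h1 : N'.det = ((N.det : ℝ) : ℂ) := (Complex.ofRealHom.map_det N).symm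
  have h2 : ∀ i, (M' i).det = (((M i).det : ℝ) : ℂ) := fun i => (Complex.ofRealHom.map_det (M i)).symm
  simp only [h1, h2] at hp
  exact_mod_cast hp

section Walks
set_option linter.unusedSectionVars false
variable {V : Type*} [Fintype V] [DecidableEq V]

def pw (A : Matrix V V ℝ) : V → List V → ℝ
  | _, [] => 1
  | r, v :: l => A r v * pw A v l

def pend : V → List V → V
  | r, [] => r
  | _, v :: l => pend v l

def wsum : ℕ → (List V → ℝ) → ℝ
  | 0, F => F []
  | n + 1, F => ∑ v, wsum n (fun l => F (v :: l))

def stp (p : (V → V) × V) (v : V) : (V → V) × V :=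
  if v = p.2 then p else (Function.update (Function.update p.1 p.2 v) v v, v)

def trv : (V → V) × V → List V → (V → V) × V
  | p, [] => p
  | p, v :: l => trv (stp p v) l

def validw (E : Set (V × V)) : V → List V → Prop
  | _, [] => True
  | r, v :: l => (v = r ∨ (r, v) ∈ E) ∧ validw E v l

lemma wsum_sum {ι : Type*} (s : Finset ι) (n : ℕ) (F : ι → List V → ℝ) :
    wsum n (fun l => ∑ i ∈ s, F i l) = ∑ i ∈ s, wsum n (F i) := by
  induction n generalizing F with
  | zero => rfl
  | succ n ih =>
    simp only [wsum]
    rw [Finset.sum_comm]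
    exact Finset.sum_congr rfl fun v _ => ih _

lemma wsum_mul (a : ℝ) (n : ℕ) (F : List V → ℝ) :
    wsum n (fun l => a * F l) = a * wsum n F := by
  induction n generalizing F with
  | zero => rfl
  | succ n ih =>
    simp only [wsum, ih, Finset.mul_sum]

lemma wsum_add (n : ℕ) (F G : List V → ℝ) :
    wsum n (fun l => F l + G l) = wsum n F + wsum n G := by
  induction n generalizing F G with
  | zero => rfl
  | succ n ih =>
    simp only [wsum, ih, Finset.sum_add_distrib]

lemma validw_of_pw (E : Set (V × V)) (A : Matrix V V ℝ)
    (hA : ∀ i j, i ≠ j → (i, j) ∉ E → A i j = 0) (r : V) (l : List V) (h : pw A r l ≠ 0) :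
    validw E r l := by
  induction l generalizing r with
  | nil => trivial
  | cons v l ih =>
    have h' : A r v ≠ 0 ∧ pw A v l ≠ 0 := mul_ne_zero_iff.1 h
    refine ⟨?_, ih v h'.2⟩
    by_contra hc
    push Not at hc
    exact h'.1 (hA r v hc.1.symm hc.2)

lemma stp_snd (p : (V → V) × V) (v : V) : (stp p v).2 = v := by
  unfold stp; split_ifs with h
  · exact h.symm
  · rfl

lemma trv_snd (p : (V → V) × V) (l : List V) : (trv p l).2 = pend p.2 l := by
  induction l generalizing p with
  | nil => rfl
  | cons v l ih => simp only [trv, pend, ih, stp_snd]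

lemma trv_not_mem (p : (V → V) × V) (l : List V) (u : V) (hu : u ∉ p.2 :: l) :
    (trv p l).1 u = p.1 u := by
  induction l generalizing p with
  | nil => rfl
  | cons v l ih =>
    simp only [List.mem_cons, not_or] at hu
    simp only [trv]
    rw [ih]
    · unfold stp; split_ifs with h
      · rfl
      · simp [Function.update_of_ne, hu.1, hu.2.1]
    · rw [stp_snd]; simp [hu]

lemma trv_congr (p q : (V → V) × V) (l : List V) (S : Finset V) (h2 : p.2 = q.2) (hr : p.2 ∈ S)
    (hS : ∀ u ∈ S, p.1 u = q.1 u) (u : V) (hu : u ∈ S ∨ u ∈ l) :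
    (trv p l).1 u = (trv q l).1 u := by
  induction l generalizing p q S with
  | nil => exact hS u (by simpa using hu)
  | cons v l ih =>
    simp only [trv]
    by_cases hv : v = p.2
    · have hvl : u ∈ S ∨ u ∈ l := by
        simp only [List.mem_cons] at hu
        rcases hu with hu | hu | hu
        · exact Or.inl hu
        · left; rw [hu, hv]; exact hr
        · exact Or.inr hu
      have e1 : stp p v = p := by simp [stp, hv]
      have e2 : stp q v = q := by simp [stp, hv, h2]
      rw [e1, e2]
      exact ih p q S h2 hr hS hvl
    · refine ih _ _ (insert v S) (by simp [stp_snd]) (by simp [stp_snd]) ?_ ?_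
      · intro w hw
        have hv' : v ≠ q.2 := h2 ▸ hv
        simp only [stp, hv, hv', if_false]
        rw [h2]
        by_cases hwv : w = v
        · simp [hwv]
        · simp only [Finset.mem_insert, hwv, false_or] at hw
          by_cases hwq : w = q.2
          · rw [Function.update_of_ne hwv, Function.update_of_ne hwv, hwq]; simp
          · simp [Function.update_of_ne hwv, Function.update_of_ne hwq, hS w hw]
      · simp only [List.mem_cons] at hu
        simp only [Finset.mem_insert]; tauto

structure TreeOn (E : Set (V × V)) (W : Finset V) (p : (V → V) × V) : Prop where
  mem : p.2 ∈ W
  fix : p.1 p.2 = p.2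
  edge : ∀ v ∈ W, v ≠ p.2 → (v, p.1 v) ∈ E ∧ p.1 v ∈ W
  reach : ∀ v ∈ W, ∃ n, p.1^[n] v = p.2

lemma reach_update (f : V → V) (r u : V) (hur : u ≠ r) (n : ℕ) (v : V) (h : f^[n] v = r) :
    ∃ m, (Function.update (Function.update f r u) u u)^[m] v = u := by
  induction n generalizing v with
  | zero =>
    refine ⟨1, ?_⟩
    simp only [Function.iterate_zero, id] at h
    subst h
    simp [Function.update_of_ne hur.symm]
  | succ n ih =>
    by_cases hv : v = u
    · exact ⟨0, hv⟩
    by_cases hvr : v = r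
    · refine ⟨1, ?_⟩
      subst hvr
      simp [Function.update_of_ne hv]
    obtain ⟨m, hm⟩ := ih (f v) h
    refine ⟨m + 1, ?_⟩
    rw [Function.iterate_succ_apply, Function.update_of_ne hv, Function.update_of_ne hvr, hm]

lemma TreeOn.stp {E : Set (V × V)} {W : Finset V} {p : (V → V) × V} (h : TreeOn E W p) (v : V)
    (hv : v = p.2 ∨ (p.2, v) ∈ E) : TreeOn E (insert v W) (stp p v) := by
  by_cases hvr : v = p.2
  · have e1 : _root_.stp p v = p := by simp [_root_.stp, hvr]
    have e2 : insert v W = W := by rw [hvr]; exact Finset.insert_eq_of_mem h.mem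
    rw [e1, e2]; exact h
  · have hE := hv.resolve_left hvr
    have e1 : _root_.stp p v = (Function.update (Function.update p.1 p.2 v) v v, v) := by
      simp [_root_.stp, hvr]
    rw [e1]
    refine ⟨by simp, by simp, ?_, ?_⟩
    · intro w hw hwv
      simp only at hwv
      have hwW : w ∈ W := by simpa [hwv] using hw
      simp only [Function.update_of_ne hwv]
      by_cases hwr : w = p.2
      · subst hwr; simp [hE]
      · rw [Function.update_of_ne hwr]
        have := h.edge w hwW hwr
        exact ⟨this.1, Finset.mem_insert_of_mem this.2⟩
    · intro w hw
      rcases Finset.mem_insert.1 hw with rfl | hw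
      · exact ⟨0, rfl⟩
      · obtain ⟨n, hn⟩ := h.reach w hw
        exact reach_update _ _ _ hvr n w hn

lemma TreeOn.trv {E : Set (V × V)} {W : Finset V} {p : (V → V) × V} (h : TreeOn E W p)
    (l : List V) (hl : validw E p.2 l) : TreeOn E (W ∪ l.toFinset) (trv p l) := by
  induction l generalizing p W with
  | nil => simpa [_root_.trv] using h
  | cons v l ih =>
    have := ih (h.stp v hl.1) (by rw [stp_snd]; exact hl.2)
    have e : W ∪ (v :: l).toFinset = insert v W ∪ l.toFinset := by
      ext; simp
    rw [e]; exact this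

lemma treeOn_univ (E : Set (V × V)) (p : (V → V) × V) :
    TreeOn E Finset.univ p ↔ IsSpanningTree E p.2 p.1 := by
  constructor
  · intro h
    exact ⟨h.fix, fun v hv => (h.edge v (by simp) hv).1, fun v => h.reach v (by simp)⟩
  · rintro ⟨h1, h2, h3⟩
    exact ⟨by simp, h1, fun v _ hv => ⟨h2 v hv, by simp⟩, fun v _ => h3 v⟩

lemma stp_isSpanningTree {E : Set (V × V)} (t : STree E) (v : V)
    (hv : v = t.root ∨ (t.root, v) ∈ E) : IsSpanningTree E (stp t.1 v).2 (stp t.1 v).1 := by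
  rw [← treeOn_univ]
  have := ((treeOn_univ E t.1).2 t.2).stp v hv
  simpa using this

lemma card_fixed {E : Set (V × V)} (r : V) (l : List V) (hl : validw E r l)
    (he : pend r l = r) :
    Nat.card {t : STree E // t.root = r ∧ trv t.1 l = t.1} = kForest E (r :: l).toFinset := by
  set W := (r :: l).toFinset with hW
  set g := (trv ((id, r) : (V → V) × V) l).1 with hg
  have hmW : ∀ v, v ∈ W ↔ v ∈ r :: l := fun v => by simp [hW]
  have hrW : r ∈ W := by simp [hW]
  have hT0 : TreeOn E {r} ((id, r) : (V → V) × V) :=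
    ⟨by simp, rfl, by simp, fun v hv => ⟨0, by simpa using hv⟩⟩
  have hT : TreeOn E W (g, r) := by
    have := hT0.trv l hl
    have e1 : ({r} : Finset V) ∪ l.toFinset = W := by ext; simp [hW]
    have e2 : trv ((id, r) : (V → V) × V) l = (g, r) := by
      ext1
      · rfl
      · rw [trv_snd]; exact he
    rwa [e1, e2] at this
  -- description of traversal
  have htr : ∀ f : V → V, f r = r → trv (f, r) l = (fun v => if v ∈ W then g v else f v, r) := by
    intro f hf
    ext1
    · funext v
      by_cases hv : v ∈ W
      · simp only [hv, if_true]
        refine trv_congr (f, r) (id, r) l {r} rfl (by simp) ?_ v ?_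
        · intro u hu; simp only [Finset.mem_singleton] at hu; simp [hu, hf]
        · simpa [hW] using hv
      · simp only [hv, if_false]
        exact trv_not_mem (f, r) l v (by rwa [hmW] at hv)
    · rw [trv_snd]; exact he
  unfold kForest
  refine Nat.card_congr
    { toFun := fun t => ⟨fun v => if v ∈ W then v else t.1.tree v, ?_⟩
      invFun := fun F => ⟨⟨(fun v => if v ∈ W then g v else F.1 v, r), ?_⟩, rfl, ?_⟩
      left_inv := ?_
      right_inv := ?_ }
  · obtain ⟨t, ht, ht2⟩ := t
    refine ⟨fun w hw => by simp [hw], ?_, ?_⟩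
    · intro v hv
      simp only [hv, if_false]
      apply t.2.2.1
      intro hc
      apply hv
      rw [hc]
      change t.root ∈ W
      rw [ht]; exact hrW
    · intro v
      obtain ⟨n, hn⟩ := t.2.2.2 v
      have hn' : t.tree^[n] v = r := by rw [← ht]; exact hn
      clear hn
      induction n generalizing v with
      | zero => exact ⟨0, by simp only [Function.iterate_zero, id] at hn' ⊢; rw [hn']; exact hrW⟩
      | succ n ih =>
        by_cases hv : v ∈ W
        · exact ⟨0, hv⟩
        · obtain ⟨m, hm⟩ := ih _ hn'
          refine ⟨m + 1, ?_⟩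
          rw [Function.iterate_succ_apply]
          simpa only [hv, if_false] using hm
  · obtain ⟨F, hF1, hF2, hF3⟩ := F
    refine ⟨by simpa [hrW] using hT.fix, ?_, ?_⟩
    · intro v hv
      by_cases hvW : v ∈ W
      · simpa [hvW] using (hT.edge v hvW hv).1
      · simpa [hvW] using hF2 v hvW
    · intro v
      obtain ⟨n, hn⟩ := hF3 v
      induction n generalizing v with
      | zero =>
        have hv : v ∈ W := hn
        obtain ⟨m, hm⟩ := hT.reach v hv
        simp only at hm
        refine ⟨m, ?_⟩
        clear hn
        induction m generalizing v with
        | zero => exact hm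
        | succ m ih =>
          rw [Function.iterate_succ_apply] at hm ⊢
          simp only [hv, if_true]
          apply ih _ _ hm
          by_cases hvr : v = r
          · rw [hvr]; have := hT.fix; simp only at this; rw [this]; exact hrW
          · exact (hT.edge v hv hvr).2
      | succ n ih =>
        by_cases hv : v ∈ W
        · exact ih v (by
            have : ∀ n, F^[n] v = v := fun n => Function.iterate_fixed (hF1 v hv) n
            rw [this]; exact hv)
        · obtain ⟨m, hm⟩ := ih (F v) hn
          refine ⟨m + 1, ?_⟩
          rw [Function.iterate_succ_apply]
          simpa only [hv, if_false] using hm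
  · change trv (_, r) l = (_, r)
    rw [htr]
    · ext1
      · funext v; by_cases hv : v ∈ W <;> simp [hv]
      · rfl
    · simpa [hrW] using hT.fix
  · rintro ⟨⟨⟨f, r'⟩, ht⟩, hr, h2⟩
    change r' = r at hr
    subst hr
    rw [htr f ht.1] at h2
    have h3 : (fun v => if v ∈ W then g v else f v) = f := congrArg Prod.fst h2
    apply Subtype.ext
    apply Subtype.ext
    ext1
    · funext v
      have := congrFun h3 v
      by_cases hv : v ∈ W
      · simpa [hv, STree.tree] using this
      · simp [hv, STree.tree]
    · rfl
  · rintro ⟨F, hF⟩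
    apply Subtype.ext
    funext v
    by_cases hv : v ∈ W
    · simp [hv, hF.1 v hv]
    · simp [hv, STree.tree]

lemma walk_reach {E : Set (V × V)} (W : Finset V) (r : V) (l : List V) (hl : validw E r l)
    (hW : ∀ u ∈ r :: l, u ∈ W) :
    ∀ u ∈ r :: l, Relation.ReflTransGen (fun a b => a ∈ W ∧ b ∈ W ∧ (a, b) ∈ E) r u ∧
      Relation.ReflTransGen (fun a b => a ∈ W ∧ b ∈ W ∧ (a, b) ∈ E) u (pend r l) := by
  induction l generalizing r with
  | nil =>
    intro u hu
    simp only [List.mem_singleton] at hu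
    subst hu
    exact ⟨.refl, .refl⟩
  | cons v l ih =>
    have ih' := ih v hl.2 (fun u hu => hW u (List.mem_cons_of_mem _ hu))
    have hrv : Relation.ReflTransGen (fun a b => a ∈ W ∧ b ∈ W ∧ (a, b) ∈ E) r v := by
      rcases hl.1 with h | h
      · rw [h]
      · exact .single ⟨hW r (by simp), hW v (by simp), h⟩
    intro u hu
    rcases List.mem_cons.1 hu with rfl | hu
    · exact ⟨.refl, hrv.trans (ih' v (by simp)).2⟩
    · exact ⟨hrv.trans (ih' u hu).1, (ih' u hu).2⟩

lemma walk_sc {E : Set (V × V)} (r : V) (l : List V) (hl : validw E r l) (he : pend r l = r) :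
    StronglyConnectedSub E (r :: l).toFinset := by
  refine ⟨⟨r, by simp⟩, ?_⟩
  intro u hu v hv
  have h := walk_reach (r :: l).toFinset r l hl (fun u hu => List.mem_toFinset.2 hu)
  have h1 := (h u (List.mem_toFinset.1 hu)).2
  rw [he] at h1
  exact h1.trans (h v (List.mem_toFinset.1 hv)).1

lemma kForest_eq {E : Set (V × V)} (m' : Finset V → ℤ)
    (hm'univ : m' Finset.univ = 1)
    (hm' : ∀ W : Finset V, StronglyConnectedSub E W → W ≠ Finset.univ →
      m' W = (kForest E W : ℤ) -
        ∑ W' ∈ Finset.univ.filter (fun W' => StronglyConnectedSub E W' ∧ W ⊂ W'), m' W')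
    (W : Finset V) (hW : StronglyConnectedSub E W) :
    (kForest E W : ℤ) = ∑ W' ∈ Finset.univ.filter (fun W' => StronglyConnectedSub E W'),
      if W ⊆ W' then m' W' else 0 := by
  rw [← Finset.sum_filter, Finset.filter_filter]
  have e : Finset.univ.filter (fun W' => StronglyConnectedSub E W' ∧ W ⊆ W')
      = insert W (Finset.univ.filter (fun W' => StronglyConnectedSub E W' ∧ W ⊂ W')) := by
    ext W'
    simp only [Finset.mem_filter, Finset.mem_univ, true_and, Finset.mem_insert]
    constructor
    · rintro ⟨h1, h2⟩
      rcases eq_or_ssubset_of_subset h2 with h | h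
      · exact Or.inl h.symm
      · exact Or.inr ⟨h1, h⟩
    · rintro (h | ⟨h1, h2⟩)
      · subst h; exact ⟨hW, subset_rfl⟩
      · exact ⟨h1, h2.subset⟩
  rw [e, Finset.sum_insert (by simp)]
  by_cases hu : W = Finset.univ
  · subst hu
    have e2 : Finset.univ.filter (fun W' => StronglyConnectedSub E W' ∧ Finset.univ ⊂ W') = ∅ := by
      ext W'
      simp only [Finset.mem_filter, Finset.mem_univ, true_and, Finset.notMem_empty, iff_false]
      rintro ⟨_, h⟩
      exact h.2 (Finset.subset_univ _)
    rw [e2, hm'univ]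
    have : kForest E (Finset.univ : Finset V) = 1 := by
      unfold kForest
      rw [Nat.card_eq_one_iff_unique]
      refine ⟨⟨?_⟩, ⟨⟨id, ?_⟩⟩⟩
      · rintro ⟨f, hf⟩ ⟨g, hg⟩
        apply Subtype.ext
        funext v
        simp [hf.1 v, hg.1 v]
      · exact ⟨fun _ _ => rfl, by simp, fun v => ⟨0, by simp⟩⟩
    simp [this]
  · rw [hm' W hW hu]; ring

lemma sum_mem_ite (W : Finset V) (f : V → ℝ) :
    ∑ i ∈ W, f i = ∑ i, if i ∈ W then f i else 0 := by
  simp [Finset.sum_ite_mem]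

lemma subm_pow (A : Matrix V V ℝ) (W : Finset V) (n : ℕ) (i j : W) :
    (subm A W ^ n) i j = wsum n (fun l => pw A i l *
      if pend (i : V) l = j ∧ (∀ u ∈ l, u ∈ W) then 1 else 0) := by
  induction n generalizing i with
  | zero =>
    by_cases h : i = j
    · subst h; simp [wsum, pw, pend]
    · have h' : (i : V) ≠ j := fun hc => h (Subtype.ext hc)
      simp [wsum, pw, pend, h, h']
  | succ n ih =>
    rw [pow_succ', Matrix.mul_apply]
    simp only [ih, wsum]
    have e : ∀ k : W, subm A W i k = A i k := fun _ => rfl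
    simp only [e]
    rw [Finset.sum_coe_sort W (fun k : V => A i k * wsum n (fun l => pw A k l *
      if pend k l = j ∧ (∀ u ∈ l, u ∈ W) then 1 else 0))]
    rw [sum_mem_ite]
    refine Finset.sum_congr rfl fun k _ => ?_
    by_cases hk : k ∈ W
    · rw [if_pos hk, ← wsum_mul]
      congr 1
      funext l
      simp [pw, pend, hk, mul_assoc]
    · rw [if_neg hk]
      have := wsum_mul 0 n (fun _ : List V => 0)
      simpa [hk] using this.symm

lemma subm_trace (A : Matrix V V ℝ) (W : Finset V) (n : ℕ) :
    (subm A W ^ n).trace = wsum n (fun l => ∑ r : V, pw A r l *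
      (if pend r l = r then 1 else 0) * (if (r :: l).toFinset ⊆ W then 1 else 0)) := by
  rw [wsum_sum]
  simp only [Matrix.trace, Matrix.diag, subm_pow]
  rw [Finset.sum_coe_sort W (fun k : V => wsum n (fun l => pw A k l *
      if pend k l = k ∧ (∀ u ∈ l, u ∈ W) then 1 else 0))]
  rw [sum_mem_ite]
  refine Finset.sum_congr rfl fun k _ => ?_
  have hs : ∀ l : List V, (k :: l).toFinset ⊆ W ↔ k ∈ W ∧ ∀ u ∈ l, u ∈ W := by
    intro l
    simp [Finset.subset_iff]
  simp only [hs]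
  by_cases hk : k ∈ W
  · rw [if_pos hk]
    congr 1
    funext l
    by_cases h1 : pend k l = k <;> simp [hk, h1]
  · rw [if_neg hk]
    have := wsum_mul 0 n (fun _ : List V => 0)
    simpa [hk] using this.symm

variable (E : Set (V × V)) (x : V → V → ℝ) (y : V → ℝ)

lemma schrodinger_zero (hx : ∀ i j : V, (i, j) ∉ E → x i j = 0) (i j : V) (hij : i ≠ j)
    (h : (i, j) ∉ E) : schrodinger x y i j = 0 := by
  simp [schrodinger, hij, hx i j h]

lemma lift_apply (hx : ∀ i j : V, (i, j) ∉ E → x i j = 0) (t s : STree E) :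
    schrodingerLift E x y t s = ∑ v, schrodinger x y t.root v * if stp t.1 v = s.1 then 1 else 0 := by
  rw [Finset.sum_eq_single s.root]
  · unfold schrodingerLift
    by_cases hts : t = s
    · subst hts
      have : stp t.1 t.root = t.1 := by simp [stp, STree.root]
      simp [this, schrodinger]
    · rw [if_neg hts]
      by_cases hr : t.root = s.root
      · have h1 : ¬ STreeEdge E t s := fun h => h.1 hr
        have h2 : stp t.1 s.root ≠ s.1 := by
          rw [← hr]
          have : stp t.1 t.root = t.1 := by simp [stp, STree.root]
          rw [this]
          exact fun h => hts (Subtype.ext h)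
        simp [h1, h2]
      · by_cases hE : (t.root, s.root) ∈ E
        · have h3 : STreeEdge E t s ↔ stp t.1 s.root = s.1 := by
            have : ¬ s.root = t.1.2 := fun h => hr h.symm
            unfold STreeEdge stp
            rw [if_neg this]
            constructor
            · rintro ⟨_, _, h⟩
              ext1
              · exact h.symm
              · rfl
            · intro h
              exact ⟨hr, hE, (congrArg Prod.fst h).symm⟩
          simp only [h3]
          by_cases h : stp t.1 s.root = s.1 <;> simp [h, schrodinger, hr]
        · have h1 : ¬ STreeEdge E t s := fun h => hE h.2.1
          simp [h1, schrodinger_zero E x y hx _ _ hr hE]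
  · intro v _ hv
    rw [if_neg, mul_zero]
    intro h
    apply hv
    rw [← stp_snd t.1 v, h]
    rfl
  · simp

lemma lift_pow (hx : ∀ i j : V, (i, j) ∉ E → x i j = 0) (n : ℕ) (t s : STree E) :
    (schrodingerLift E x y ^ n) t s = wsum n (fun l => pw (schrodinger x y) t.root l *
      if trv t.1 l = s.1 then 1 else 0) := by
  induction n generalizing t with
  | zero =>
    by_cases h : t = s
    · subst h; simp [wsum, pw, trv]
    · have h' : t.1 ≠ s.1 := fun hc => h (Subtype.ext hc)
      simp [wsum, pw, trv, h, h']
  | succ n ih =>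
    rw [pow_succ', Matrix.mul_apply]
    simp only [ih, wsum, lift_apply E x y hx, Finset.sum_mul]
    rw [Finset.sum_comm]
    refine Finset.sum_congr rfl fun v _ => ?_
    by_cases hA : schrodinger x y t.root v = 0
    · have := wsum_mul 0 n (fun _ : List V => 0)
      simpa [pw, hA] using this.symm
    · have hv : v = t.root ∨ (t.root, v) ∈ E := by
        by_contra hc
        push Not at hc
        exact hA (schrodinger_zero E x y hx _ _ hc.1.symm hc.2)
      rw [Finset.sum_eq_single (⟨stp t.1 v, stp_isSpanningTree t v hv⟩ : STree E)]
      · simp only [if_true, mul_one]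
        rw [← wsum_mul]
        congr 1
        funext l
        simp only [pw, trv, STree.root, stp_snd]
        by_cases h : trv (stp t.1 v) l = s.1 <;> simp [h]
      · intro b _ hb
        rw [if_neg]
        · simp
        · intro h; exact hb (Subtype.ext h.symm)
      · simp

lemma lift_trace (hx : ∀ i j : V, (i, j) ∉ E → x i j = 0) (n : ℕ) :
    (schrodingerLift E x y ^ n).trace = wsum n (fun l => ∑ r : V, pw (schrodinger x y) r l *
      (if pend r l = r then 1 else 0) * (kForest E (r :: l).toFinset : ℝ)) := by
  simp only [Matrix.trace, Matrix.diag, lift_pow E x y hx]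
  rw [← wsum_sum]
  congr 1
  funext l
  rw [← Finset.sum_fiberwise Finset.univ (fun t : STree E => t.root)]
  refine Finset.sum_congr rfl fun r _ => ?_
  have e : ∑ t ∈ Finset.univ.filter (fun t : STree E => t.root = r),
      pw (schrodinger x y) t.root l * (if trv t.1 l = t.1 then (1 : ℝ) else 0)
      = pw (schrodinger x y) r l *
        (Nat.card {t : STree E // t.root = r ∧ trv t.1 l = t.1} : ℝ) := by
    rw [Nat.card_eq_fintype_card, Fintype.card_subtype, ← Finset.filter_filter,
      ← Finset.sum_boole, Finset.mul_sum]
    refine Finset.sum_congr rfl fun t ht => ?_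
    rw [(Finset.mem_filter.1 ht).2]
  rw [e]
  by_cases h0 : pw (schrodinger x y) r l = 0
  · simp [h0]
  have hl := validw_of_pw E _ (schrodinger_zero E x y hx) r l h0
  by_cases he : pend r l = r
  · rw [card_fixed r l hl he]; simp [he]
  · have : IsEmpty {t : STree E // t.root = r ∧ trv t.1 l = t.1} := by
      refine ⟨?_⟩
      rintro ⟨t, h1, h2⟩
      apply he
      have h3 := trv_snd t.1 l
      rw [h2] at h3
      change t.root = pend t.root l at h3
      rw [h1] at h3
      exact h3.symm
    simp [he]

lemma traces_eq (hx : ∀ i j : V, (i, j) ∉ E → x i j = 0)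
    (m' : Finset V → ℤ)
    (hm'univ : m' Finset.univ = 1)
    (hm' : ∀ W : Finset V, StronglyConnectedSub E W → W ≠ Finset.univ →
      m' W = (kForest E W : ℤ) -
        ∑ W' ∈ Finset.univ.filter (fun W' => StronglyConnectedSub E W' ∧ W ⊂ W'), m' W') (n : ℕ) :
    (schrodingerLift E x y ^ n).trace +
      ∑ W ∈ Finset.univ.filter (fun W : Finset V => StronglyConnectedSub E W),
        ((-(m' W)).toNat : ℝ) * (subm (schrodinger x y) W ^ n).trace
    = ∑ W ∈ Finset.univ.filter (fun W : Finset V => StronglyConnectedSub E W),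
        ((m' W).toNat : ℝ) * (subm (schrodinger x y) W ^ n).trace := by
  rw [lift_trace E x y hx]
  simp only [subm_trace, ← wsum_mul]
  rw [← wsum_sum, ← wsum_sum, ← wsum_add]
  congr 1
  funext l
  simp only [Finset.mul_sum]
  rw [Finset.sum_comm, ← Finset.sum_add_distrib,
    Finset.sum_comm (s := Finset.univ.filter (fun W : Finset V => StronglyConnectedSub E W))]
  refine Finset.sum_congr rfl fun r _ => ?_
  set c : ℝ := pw (schrodinger x y) r l * (if pend r l = r then 1 else 0) with hc
  by_cases h0 : c = 0
  · simp [h0]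
  rw [hc] at h0
  have h0' := mul_ne_zero_iff.1 h0
  have hl := validw_of_pw E _ (schrodinger_zero E x y hx) r l h0'.1
  have he : pend r l = r := by
    by_contra h; exact h0'.2 (if_neg h)
  have hk := kForest_eq m' hm'univ hm' _ (walk_sc r l hl he)
  have hk' : (kForest E (r :: l).toFinset : ℝ) = ∑ W ∈ Finset.univ.filter
      (fun W : Finset V => StronglyConnectedSub E W),
      (((m' W).toNat : ℝ) - ((-(m' W)).toNat : ℝ)) * (if (r :: l).toFinset ⊆ W then 1 else 0) := by
    have := congrArg (Int.cast : ℤ → ℝ) hk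
    rw [Int.cast_natCast] at this
    rw [this, Int.cast_sum]
    refine Finset.sum_congr rfl fun W _ => ?_
    have h5 : ((m' W : ℤ) : ℝ) = ((m' W).toNat : ℝ) - ((-(m' W)).toNat : ℝ) := by
      have := Int.toNat_sub_toNat_neg (m' W)
      exact_mod_cast this.symm
    split_ifs <;> simp [h5]
  rw [hk', Finset.mul_sum, ← Finset.sum_add_distrib]
  refine Finset.sum_congr rfl fun W _ => ?_
  ring

end Walks

/-- `det H̄ = ∏_{W strongly connected ⊆ V} det(H|_W)^{m'(W)}`. -/
theorem stmt10 {V : Type*} [Fintype V] [DecidableEq V] [Nonempty V]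
    (E : Set (V × V)) (hloop : ∀ v : V, (v, v) ∉ E) (hconn : StronglyConnected E)
    (x : V → V → ℝ) (hx : ∀ i j : V, (i, j) ∉ E → x i j = 0)
    (y : V → ℝ)
    (m' : Finset V → ℤ)
    (hm'univ : m' Finset.univ = 1)
    (hm' : ∀ W : Finset V, StronglyConnectedSub E W → W ≠ Finset.univ →
      m' W = (kForest E W : ℤ) -
        ∑ W' ∈ Finset.univ.filter (fun W' => StronglyConnectedSub E W' ∧ W ⊂ W'), m' W') :
    Matrix.det (schrodingerLift E x y) *
      ∏ W ∈ Finset.univ.filter (fun W : Finset V => StronglyConnectedSub E W),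
        Matrix.det (subm (schrodinger x y) W) ^ (-(m' W)).toNat
    = ∏ W ∈ Finset.univ.filter (fun W : Finset V => StronglyConnectedSub E W),
        Matrix.det (subm (schrodinger x y) W) ^ (m' W).toNat := by
  exact det_of_traces _ (schrodingerLift E x y) (fun W => subm (schrodinger x y) W) _ _
    (traces_eq E x y hx m' hm'univ hm')
end
end

section
/- Let P be a transition matrix associated with G and P̄ its lift to the spanning tree graph. Then in the polynomial ring ℝ[X], the polynomial det(1 − X • (P.map Polynomial.C)) divides the polynomial det(1 − X • (P̄.map Polynomial.C)); that is, the ratio R(s) = det(I − sP̄)/det(I − sP) is a polynomial in s. -/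
open Matrix Finset Classical

noncomputable section

theorem aux_det_dvd {R m n : Type*} [CommRing R] [Fintype m] [DecidableEq m] [Fintype n]
    [DecidableEq n] (A : Matrix m m R) (D : Matrix n n R) (B : Matrix m n R) (σ : n → m)
    (hσ : Function.Injective σ) (hB : ∀ i j, B (σ i) j = (1 : Matrix n n R) i j)
    (h : A * B = B * D) : D.det ∣ A.det := by
  let e : n ⊕ ((Set.range σ)ᶜ : Set m) ≃ m :=
    (Equiv.sumCongr (Equiv.ofInjective σ hσ) (Equiv.refl _)).trans (Equiv.Set.sumCompl (Set.range σ))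
  have he : ∀ i, e (Sum.inl i) = σ i := fun i => rfl
  obtain ⟨A', hA'⟩ : ∃ A', A' = A.submatrix e e := ⟨_, rfl⟩
  obtain ⟨B', hB'⟩ : ∃ B', B' = B.submatrix e id := ⟨_, rfl⟩
  have h' : A' * B' = B' * D := by
    rw [hA', hB', Matrix.submatrix_mul_equiv A B e e id, h]
    ext i j
    simp [Matrix.mul_apply]
  have hdet : A'.det = A.det := by rw [hA', Matrix.det_submatrix_equiv_self e A]
  have hB1 : B'.toRows₁ = 1 := by
    ext i j
    rw [Matrix.toRows₁_apply, hB', Matrix.submatrix_apply, he, id, hB]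
  rw [← Matrix.fromRows_toRows B', ← Matrix.fromBlocks_toBlocks A',
    Matrix.fromBlocks_mul_fromRows, Matrix.fromRows_mul, Matrix.fromRows_ext_iff, hB1,
    mul_one, Matrix.mul_one, Matrix.one_mul] at h'
  obtain ⟨h1, h2⟩ := h'
  have key : A' * Matrix.fromBlocks 1 0 B'.toRows₂ 1 = Matrix.fromBlocks 1 0 B'.toRows₂ 1 *
      Matrix.fromBlocks D A'.toBlocks₁₂ 0 (A'.toBlocks₂₂ - B'.toRows₂ * A'.toBlocks₁₂) := by
    conv_lhs => rw [← Matrix.fromBlocks_toBlocks A']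
    rw [Matrix.fromBlocks_multiply, Matrix.fromBlocks_multiply]
    simp [h1, h2]
  have := congrArg Matrix.det key
  rw [Matrix.det_mul, Matrix.det_mul, Matrix.det_fromBlocks_zero₁₂,
    Matrix.det_fromBlocks_zero₂₁, hdet] at this
  simp only [Matrix.det_one, mul_one, one_mul] at this
  exact ⟨_, this⟩

def auxQ {V : Type*} (E : Set (V × V)) (r : V) : ℕ → V → Prop
  | 0, v => v = r
  | n + 1, v => ∃ w, (v, w) ∈ E ∧ auxQ E r n w

theorem aux_tree {V : Type*} (E : Set (V × V)) (hconn : StronglyConnected E) (r : V) :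
    ∃ t : V → V, IsSpanningTree E r t := by
  have hQ : ∀ v, ∃ n, auxQ E r n v := by
    intro v
    induction hconn v r using Relation.ReflTransGen.head_induction_on with
    | refl => exact ⟨0, rfl⟩
    | head h _ ih => exact ⟨ih.choose + 1, _, h, ih.choose_spec⟩
  let d : V → ℕ := fun v => Nat.find (hQ v)
  have hd : ∀ v, v ≠ r → ∃ w, (v, w) ∈ E ∧ d w < d v := by
    intro v hv
    have h1 : auxQ E r (d v) v := Nat.find_spec (hQ v)
    rcases h2 : d v with _ | k
    · rw [h2] at h1
      exact absurd h1 hv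
    · rw [h2] at h1
      obtain ⟨w, hw, hw2⟩ := h1
      exact ⟨w, hw, Nat.lt_succ_of_le (Nat.find_min' (hQ w) hw2)⟩
  choose! f hf using hd
  let t : V → V := fun v => if v = r then r else f v
  have ht : ∀ v, v ≠ r → t v = f v := fun v hv => if_neg hv
  refine ⟨t, if_pos rfl, fun v hv => by rw [ht v hv]; exact (hf v hv).1, ?_⟩
  have : ∀ n v, d v ≤ n → ∃ k, t^[k] v = r := by
    intro n
    induction n with
    | zero =>
      intro v hv
      by_cases h : v = r
      · exact ⟨0, h⟩
      · have := (hf v h).2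
        omega
    | succ n ih =>
      intro v hv
      by_cases h : v = r
      · exact ⟨0, h⟩
      · have := (hf v h).2
        obtain ⟨k, hk⟩ := ih (f v) (by omega)
        exact ⟨k + 1, by rw [Function.iterate_succ_apply, ht v h, hk]⟩
  exact fun v => this _ v le_rfl

theorem aux_step {V : Type*} [DecidableEq V] (E : Set (V × V)) (i j : V) (t : V → V)
    (h : IsSpanningTree E i t) (hij : i ≠ j) (hE : (i, j) ∈ E) :
    IsSpanningTree E j (Function.update (Function.update t i j) j j) := by
  obtain ⟨h1, h2, h3⟩ := h
  refine ⟨by simp, ?_, ?_⟩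
  · intro v hv
    by_cases hvi : v = i
    · subst hvi
      simpa [Function.update_of_ne hv] using hE
    · simpa [Function.update_of_ne hv, Function.update_of_ne hvi] using h2 v hvi
  · have key : ∀ n v, t^[n] v = i →
        ∃ k, (Function.update (Function.update t i j) j j)^[k] v = j := by
      intro n
      induction n with
      | zero =>
        intro v hv
        have hv : v = i := hv
        subst hv
        exact ⟨1, by simp [Function.update_of_ne hij]⟩
      | succ n ih =>
        intro v hv
        by_cases hvj : v = j
        · exact ⟨0, hvj⟩
        by_cases hvi : v = i
        · subst hvi
          exact ⟨1, by simp [Function.update_of_ne hij]⟩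
        obtain ⟨k, hk⟩ := ih (t v) hv
        refine ⟨k + 1, ?_⟩
        rw [Function.iterate_succ_apply, Function.update_of_ne hvj, Function.update_of_ne hvi, hk]
    intro v
    obtain ⟨n, hn⟩ := h3 v
    exact key n v hn

theorem aux_sum {V : Type*} [Fintype V] [DecidableEq V] (E : Set (V × V))
    (P : Matrix V V ℝ) (hP : IsTransMatrix E P) (t : STree E) (j : V) :
    ∑ t' : STree E, liftP E P t t' * (if t'.root = j then 1 else 0) = P t.root j := by
  by_cases hj : t.root = j
  · subst hj
    rw [Finset.sum_eq_single t]
    · simp [liftP]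
    · intro b _ hb
      by_cases hr : b.root = t.root
      · simp [liftP, STreeEdge, hr, Ne.symm hb]
      · simp [hr]
    · simp
  by_cases hE : (t.root, j) ∈ E
  · let s : STree E := ⟨(Function.update (Function.update t.tree t.root j) j j, j),
      aux_step E t.root j t.tree t.2 hj hE⟩
    have hs : s.root = j := rfl
    have hts : t ≠ s := fun h => hj (by rw [h, hs])
    rw [Finset.sum_eq_single s]
    · have : STreeEdge E t s := ⟨hj, hE, rfl⟩
      simp [liftP, hts, this, hs]
    · intro b _ hb
      by_cases hr : b.root = j
      · have h1 : t ≠ b := fun h => hj (by rw [h, hr])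
        have h2 : ¬ STreeEdge E t b := by
          rintro ⟨_, _, h⟩
          rw [hr] at h
          exact hb (Subtype.ext (Prod.ext h hr))
        simp [liftP, h1, h2]
      · simp [hr]
    · simp
  · have h0 : P t.root j = 0 :=
      le_antisymm (not_lt.1 fun h => hE ((hP.2.2 _ _ hj).1 h)) (hP.1 _ _)
    rw [h0]
    refine Finset.sum_eq_zero fun b _ => ?_
    by_cases hr : b.root = j
    · have h1 : t ≠ b := fun h => hj (by rw [h, hr])
      have h2 : ¬ STreeEdge E t b := by
        rintro ⟨_, h, _⟩
        exact hE (hr ▸ h)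
      simp [liftP, h1, h2]
    · simp [hr]

/-- `det(I - sP)` divides `det(I - sP̄)` in `ℝ[X]`; i.e. the ratio
`R(s)` is a polynomial in `s`. -/
theorem stmt11 {V : Type*} [Fintype V] [DecidableEq V] [Nonempty V]
    (E : Set (V × V)) (hloop : ∀ v : V, (v, v) ∉ E) (hconn : StronglyConnected E)
    (P : Matrix V V ℝ) (hP : IsTransMatrix E P) :
    Matrix.det ((1 : Matrix V V (Polynomial ℝ)) -
        (Polynomial.X : Polynomial ℝ) • (P.map Polynomial.C)) ∣
      Matrix.det ((1 : Matrix (STree E) (STree E) (Polynomial ℝ)) -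
        (Polynomial.X : Polynomial ℝ) • ((liftP E P).map Polynomial.C)) := by
  choose τ hτ using aux_tree E hconn
  let σ : V → STree E := fun v => ⟨(τ v, v), hτ v⟩
  have hσ : ∀ v, (σ v).root = v := fun v => rfl
  let B : Matrix (STree E) V ℝ := fun t v => if t.root = v then 1 else 0
  have hB : liftP E P * B = B * P := by
    ext t j
    rw [Matrix.mul_apply, aux_sum E P hP t j, Matrix.mul_apply]
    simp [B]
  refine aux_det_dvd _ _ (B.map Polynomial.C) σ (fun a b h => by rw [← hσ a, h, hσ b]) ?_ ?_
  · intro i j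
    have : B (σ i) j = if i = j then 1 else 0 := rfl
    rw [Matrix.map_apply, this, Matrix.one_apply]
    split_ifs <;> simp
  · rw [Matrix.sub_mul, Matrix.mul_sub, Matrix.one_mul, Matrix.mul_one, Matrix.smul_mul, Matrix.mul_smul]
    rw [← Matrix.map_mul, ← Matrix.map_mul, hB]
end
end

section
/- In the multivariate polynomial ring MvPolynomial (V × V) ℤ, with one variable X_{(i,j)} for each ordered pair, the spanning tree polynomial of G, τ(G) = ∑_{t ∈ V̄} ∏_{v ≠ root(t)} X_{(v, t v)}, divides the spanning tree polynomial of the spanning tree graph Ḡ, τ(Ḡ) = ∑_{T} ∏_{t ≠ root(T)} X_{(root t, root (T t))}, where the latter sum ranges over all spanning trees T of Ḡ over all roots. (That is, Biane's rational function Φ_G = τ(Ḡ)/τ(G) is a polynomial in the edge weights.) -/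
open Matrix Finset Classical

noncomputable section

section Helpers

open Polynomial in
/-- entry coefficients -/
def bwC {V R : Type*} [DecidableEq V] [CommRing R] (w : V → V → R) (v u : V) : R[X] :=
  if u = v then Polynomial.X else Polynomial.C (w v u)

def bwRow {V S : Type*} [DecidableEq V] [CommRing S] (v u k : V) : S :=
  (if k = v then 1 else 0) - (if k = u ∧ u ≠ v then 1 else 0)

open Polynomial in
def bwMat {V R : Type*} [Fintype V] [DecidableEq V] [CommRing R] (w : V → V → R) :
    Matrix V V R[X] :=
  fun v k => ∑ u, bwC w v u * bwRow v u k

def bwAcyc {V : Type*} (f : V → V) : Prop := ∀ v, ∃ n, f (f^[n] v) = f^[n] v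

theorem bw_det_acyc {V S : Type*} [Fintype V] [DecidableEq V] [CommRing S] (f : V → V)
    (hf : bwAcyc f) : Matrix.det (fun v k => (bwRow v (f v) k : S)) = 1 := by
  set d : V → ℕ := fun v => Nat.find (hf v) with hd
  have hlt : ∀ v, f v ≠ v → d (f v) < d v := by
    intro v hv
    have h1 := Nat.find_spec (hf v)
    rcases hn : Nat.find (hf v) with _ | n
    · rw [hn] at h1; exact absurd h1 hv
    · rw [hn] at h1
      have : d (f v) ≤ n := Nat.find_min' (hf (f v)) (by simpa using h1)
      show d (f v) < Nat.find (hf v)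
      omega
  set M : Matrix V V S := fun v k => (bwRow v (f v) k : S) with hM
  have hne : ∀ i j, d i ≤ d j → M i j = (1 : Matrix V V S) i j := by
    intro i j hij
    have : ¬ (j = f i ∧ f i ≠ i) := by
      rintro ⟨h1, h2⟩
      have := hlt i h2
      rw [← h1] at this; omega
    simp only [hM, bwRow, if_neg this, sub_zero, Matrix.one_apply, eq_comm]
  have hbt : (Mᵀ).BlockTriangular d := by
    intro i j hij
    rw [Matrix.transpose_apply, hne j i hij.le, Matrix.one_apply_ne]
    rintro rfl; exact lt_irrefl _ hij
  rw [← Matrix.det_transpose, hbt.det]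
  apply Finset.prod_eq_one
  intro a _
  have : (Mᵀ).toSquareBlock d a = 1 := by
    ext i j
    rw [Matrix.toSquareBlock_def]
    simp only [Matrix.of_apply, Matrix.transpose_apply]
    rw [hne _ _ (by rw [i.2, j.2])]
    simp only [Matrix.one_apply, Subtype.ext_iff, eq_comm]
  rw [this, Matrix.det_one]

theorem bw_det_cyc {V S : Type*} [Fintype V] [DecidableEq V] [CommRing S] (f : V → V)
    (hf : ¬ bwAcyc f) : Matrix.det (fun v k => (bwRow v (f v) k : S)) = 0 := by
  classical
  set M : Matrix V V S := fun v k => (bwRow v (f v) k : S) with hM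
  unfold bwAcyc at hf
  push Not at hf
  obtain ⟨v0, h0⟩ := hf
  set x : V → S := fun v => if ∀ n, f (f^[n] v) ≠ f^[n] v then 1 else 0 with hx
  have hMx : M *ᵥ x = 0 := by
    ext v
    have h1 : (M *ᵥ x) v = x v - if f v ≠ v then x (f v) else 0 := by
      simp only [Matrix.mulVec, dotProduct, hM, bwRow, sub_mul, Finset.sum_sub_distrib, ite_mul,
        one_mul, zero_mul]
      by_cases h : f v = v <;> simp [h]
    rw [h1]
    by_cases h : f v = v
    · have : ¬ ∀ n, f (f^[n] v) ≠ f^[n] v := fun hh => hh 0 h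
      simp [hx, h]
      exact fun hh => absurd h (hh 0)
    · have : (∀ n, f (f^[n] v) ≠ f^[n] v) ↔ ∀ n, f (f^[n] (f v)) ≠ f^[n] (f v) := by
        constructor
        · intro hh n
          have := hh (n + 1)
          simpa using this
        · intro hh n
          cases n with
          | zero => exact h
          | succ n => simpa using hh n
      simp only [hx, this, h, ne_eq, not_false_eq_true, if_true, sub_self, Pi.zero_apply]
  have h2 : (M.adjugate * M) *ᵥ x = 0 := by
    rw [← Matrix.mulVec_mulVec, hMx, Matrix.mulVec_zero]
  rw [Matrix.adjugate_mul, Matrix.smul_mulVec, Matrix.one_mulVec] at h2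
  have h3 := congrFun h2 v0
  have : x v0 = 1 := by simp only [hx]; rw [if_pos h0]
  simpa [this] using h3

theorem bw_det_sum {V R : Type*} [Fintype V] [DecidableEq V] [CommRing R] (w : V → V → R) :
    (bwMat w).det = ∑ f : V → V, (∏ v, bwC w v (f v)) *
      Matrix.det (fun v k => (bwRow v (f v) k : Polynomial R)) := by
  have h := (Matrix.detRowAlternating (n := V) (R := Polynomial R)).toMultilinearMap.map_sum
    (fun v u => bwC w v u • (fun k => (bwRow v u k : Polynomial R)))
  have h2 : (fun i => ∑ j, bwC w i j • fun k => (bwRow i j k : Polynomial R)) = bwMat w := by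
    funext i k
    simp [bwMat, Finset.sum_apply]
  rw [h2] at h
  refine h.trans (Finset.sum_congr rfl fun f _ => ?_)
  exact MultilinearMap.map_smul_univ _ _ _

theorem bw_prod {V R : Type*} [Fintype V] [DecidableEq V] [CommRing R] (w : V → V → R)
    (f : V → V) : ∏ v, bwC w v (f v) =
      Polynomial.C (∏ v ∈ univ.filter (fun v => ¬ f v = v), w v (f v)) *
      Polynomial.X ^ (univ.filter (fun v => f v = v)).card := by
  simp only [bwC]
  rw [Finset.prod_ite, Finset.prod_const, mul_comm, map_prod]

theorem bw_coeff_zero {V R : Type*} [Fintype V] [DecidableEq V] [Nonempty V] [CommRing R]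
    (w : V → V → R) : (bwMat w).det.coeff 0 = 0 := by
  rw [bw_det_sum, Polynomial.finsetSum_coeff]
  apply Finset.sum_eq_zero
  intro f _
  by_cases hf : bwAcyc f
  · rw [bw_det_acyc f hf, mul_one, bw_prod, Polynomial.coeff_C_mul_X_pow, if_neg]
    obtain ⟨v⟩ := ‹Nonempty V›
    obtain ⟨n, hn⟩ := hf v
    intro h
    have := Finset.card_eq_zero.mp h.symm
    have h2 : f^[n] v ∈ univ.filter (fun v => f v = v) := by simp [hn]
    rw [this] at h2
    simp at h2
  · rw [bw_det_cyc f hf, mul_zero, Polynomial.coeff_zero]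

theorem STree.fixed_eq {V : Type*} {E : Set (V × V)} (t : STree E) (v : V) (h : t.tree v = v) :
    v = t.root := by
  obtain ⟨n, hn⟩ := t.2.2.2 v
  have : t.1.1^[n] v = v := Function.iterate_fixed h n
  exact this.symm.trans hn

theorem bw_coeff_one {V R : Type*} [Fintype V] [DecidableEq V] [CommRing R]
    (E : Set (V × V)) (x : V → V → R) :
    (bwMat (fun v u => if (v, u) ∈ E then x v u else 0)).det.coeff 1 =
      ∑ t : STree E, ∏ v ∈ univ.erase t.root, x v (t.tree v) := by
  rw [bw_det_sum, Polynomial.finsetSum_coeff]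
  symm
  apply Finset.sum_of_injOn (fun t : STree E => t.tree)
  · intro s _ t _ hst
    have hst' : s.tree = t.tree := hst
    apply Subtype.ext
    refine Prod.ext hst ?_
    apply STree.fixed_eq t s.root
    rw [← hst']
    exact s.2.1
  · intro t _; simp
  · intro f _ hf
    by_cases ha : bwAcyc f
    · rw [bw_det_acyc f ha, mul_one, bw_prod, Polynomial.coeff_C_mul_X_pow]
      split_ifs with h1
      · obtain ⟨r, hr⟩ := Finset.card_eq_one.mp h1.symm
        have hr' : ∀ v, f v = v ↔ v = r := by
          intro v
          have : v ∈ univ.filter (fun v => f v = v) ↔ v ∈ ({r} : Finset V) := by rw [hr]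
          simpa using this
        by_contra hne
        apply hf
        have hE : ∀ v, v ≠ r → (v, f v) ∈ E := by
          intro v hv
          by_contra hvE
          apply hne
          apply Finset.prod_eq_zero (i := v)
          · simp [hr', hv]
          · simp [hvE]
        refine ⟨⟨(f, r), (hr' r).2 rfl, hE, fun v => ?_⟩, by simp, rfl⟩
        obtain ⟨n, hn⟩ := ha v
        exact ⟨n, (hr' _).1 hn⟩
      · rfl
    · rw [bw_det_cyc f ha, mul_zero, Polynomial.coeff_zero]
  · intro t _
    have ha : bwAcyc t.tree := by
      intro v
      obtain ⟨n, hn⟩ := t.2.2.2 v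
      refine ⟨n, ?_⟩
      have hn' : t.tree^[n] v = t.root := hn
      rw [hn']; exact t.2.1
    have hfix : ∀ v, t.tree v = v ↔ v = t.root :=
      fun v => ⟨t.fixed_eq v, fun h => h ▸ t.2.1⟩
    have hcard : (univ.filter (fun v => t.tree v = v)).card = 1 := by
      simp [hfix, Finset.filter_eq']
    rw [bw_det_acyc _ ha, mul_one, bw_prod, Polynomial.coeff_C_mul_X_pow, hcard, if_pos rfl]
    have : univ.filter (fun v => ¬ t.tree v = v) = univ.erase t.root := by
      ext v; simp [hfix]
    rw [this]
    apply Finset.prod_congr rfl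
    intro v hv
    rw [if_pos]
    exact t.2.2.1 v (Finset.ne_of_mem_erase hv)

theorem bw_det_dvd {m n S : Type*} [Fintype m] [DecidableEq m] [Fintype n] [DecidableEq n]
    [CommRing S] (p : m → n) (hp : Function.Surjective p) (A : Matrix m m S) (B : Matrix n n S)
    (h : ∀ t v, ∑ k, A t k * (if p k = v then 1 else 0) = B (p t) v) : B.det ∣ A.det := by
  classical
  obtain ⟨s, hs⟩ := hp.hasRightInverse
  have hinj : Function.Injective s := hs.injective
  let e : n ⊕ ↥(Set.range s)ᶜ ≃ m :=
    (Equiv.sumCongr (Equiv.ofInjective s hinj) (Equiv.refl _)).trans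
      (Equiv.Set.sumCompl (Set.range s))
  have e1 : ∀ v, e (Sum.inl v) = s v := fun v => by simp [e]
  let A' := A.submatrix e e
  let N : Matrix ↥(Set.range s)ᶜ n S := fun k v => if p (e (Sum.inr k)) = v then 1 else 0
  have key : ∀ t v, A' t (Sum.inl v) + ∑ k, A' t (Sum.inr k) * N k v = B (p (e t)) v := by
    intro t v
    rw [← h (e t) v, ← Equiv.sum_comp e, Fintype.sum_sum_type]
    simp only [e1, hs _]
    simp [A', N, e1]
  have h11 : A'.toBlocks₁₁ + A'.toBlocks₁₂ * N = B := by
    ext i v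
    have := key (Sum.inl i) v
    rw [e1, hs] at this
    simpa [Matrix.mul_apply, Matrix.toBlocks₁₁, Matrix.toBlocks₁₂] using this
  have h21 : A'.toBlocks₂₁ + A'.toBlocks₂₂ * N = N * B := by
    ext i v
    have := key (Sum.inr i) v
    have hNB : (N * B) i v = B (p (e (Sum.inr i))) v := by
      rw [Matrix.mul_apply]; simp [N]
    rw [hNB, ← this, Matrix.add_apply, Matrix.mul_apply]
    rfl
  have hmul : A' * Matrix.fromBlocks 1 0 N 1 = Matrix.fromBlocks 1 0 N 1 *
      Matrix.fromBlocks B A'.toBlocks₁₂ 0 (A'.toBlocks₂₂ - N * A'.toBlocks₁₂) := by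
    conv_lhs => rw [← Matrix.fromBlocks_toBlocks A']
    rw [Matrix.fromBlocks_multiply, Matrix.fromBlocks_multiply]
    simp [h11, h21]
  have hdet := congrArg Matrix.det hmul
  rw [Matrix.det_mul, Matrix.det_mul, Matrix.det_fromBlocks_zero₁₂, Matrix.det_fromBlocks_zero₂₁,
    Matrix.det_one, Matrix.det_one, one_mul, mul_one, one_mul] at hdet
  have : A'.det = A.det := Matrix.det_submatrix_equiv_self e A
  rw [← this, hdet]
  exact dvd_mul_right _ _

theorem bw_step {V : Type*} [DecidableEq V] (E : Set (V × V)) (t : STree E) (j : V)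
    (hj : t.root ≠ j) (hE : (t.root, j) ∈ E) : ∃ t' : STree E, t'.root = j ∧ STreeEdge E t t' := by
  have hst : IsSpanningTree E j (Function.update (Function.update t.tree t.root j) j j) := by
    refine ⟨by simp, fun v hv => ?_, fun v => ?_⟩
    · rw [Function.update_of_ne hv]
      by_cases h : v = t.root
      · subst h; simpa using hE
      · rw [Function.update_of_ne h]; exact t.2.2.1 v h
    · obtain ⟨n, hn⟩ := t.2.2.2 v
      induction n generalizing v with
      | zero =>
        refine ⟨1, ?_⟩
        have : v = t.root := hn
        subst this
        simp [Function.update_of_ne hj]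
      | succ n ih =>
        by_cases h1 : v = j
        · exact ⟨0, h1⟩
        by_cases h2 : v = t.root
        · refine ⟨1, ?_⟩
          subst h2
          simp [Function.update_of_ne hj]
        · obtain ⟨m, hm⟩ := ih (t.1.1 v) hn
          refine ⟨m + 1, ?_⟩
          rw [Function.iterate_succ_apply, Function.update_of_ne h1, Function.update_of_ne h2]
          exact hm
  exact ⟨⟨(_, j), hst⟩, rfl, hj, hE, rfl⟩

def bwP {V : Type*} (E : Set (V × V)) (r : V) : ℕ → V → Prop
  | 0, v => v = r
  | n + 1, v => ∃ u, (v, u) ∈ E ∧ bwP E r n u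

theorem bw_exists {V : Type*} (E : Set (V × V)) (hconn : StronglyConnected E) (r : V) :
    ∃ t : STree E, t.root = r := by
  classical
  have hex : ∀ v, ∃ n, bwP E r n v := by
    intro v
    induction hconn v r using Relation.ReflTransGen.head_induction_on with
    | refl => exact ⟨0, rfl⟩
    | head h _ ih =>
      obtain ⟨n, hn⟩ := ih
      exact ⟨n + 1, _, h, hn⟩
  have hstep : ∀ v, ∃ u, (v = r → u = r) ∧
      (v ≠ r → (v, u) ∈ E ∧ Nat.find (hex u) < Nat.find (hex v)) := by
    intro v
    by_cases hv : v = r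
    · exact ⟨r, fun _ => rfl, fun h => absurd hv h⟩
    · have h1 := Nat.find_spec (hex v)
      rcases hn : Nat.find (hex v) with _ | n
      · rw [hn] at h1; exact absurd h1 hv
      · rw [hn] at h1
        obtain ⟨u, hu, hun⟩ := h1
        exact ⟨u, fun h => absurd h hv, fun _ =>
          ⟨hu, Nat.lt_succ_of_le (Nat.find_min' (hex u) hun)⟩⟩
  choose t ht1 ht2 using hstep
  refine ⟨⟨(t, r), ht1 r rfl, fun v hv => (ht2 v hv).1, ?_⟩, rfl⟩
  have : ∀ N v, Nat.find (hex v) ≤ N → ∃ n, t^[n] v = r := by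
    intro N
    induction N with
    | zero =>
      intro v hv
      by_cases h : v = r
      · exact ⟨0, h⟩
      · have := (ht2 v h).2; omega
    | succ N ih =>
      intro v hv
      by_cases h : v = r
      · exact ⟨0, h⟩
      · obtain ⟨n, hn⟩ := ih (t v) (by have := (ht2 v h).2; omega)
        exact ⟨n + 1, hn⟩
  exact fun v => this _ v le_rfl

theorem bw_lump {V R : Type*} [Fintype V] [DecidableEq V] [CommRing R] (E : Set (V × V))
    [DecidableEq (STree E)] (x : V → V → R) (t : STree E) (v : V) :
    ∑ k, bwMat (fun t t' : STree E => if (t, t') ∈ liftEdges E then x t.root t'.root else 0) t k *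
      (if k.root = v then 1 else 0) =
    bwMat (fun v u => if (v, u) ∈ E then x v u else 0) t.root v := by
  simp only [bwMat, Finset.sum_mul]
  rw [Finset.sum_comm]
  have h1 : ∀ s : STree E, ∑ k : STree E,
      bwC (fun t t' : STree E => if (t, t') ∈ liftEdges E then x t.root t'.root else 0) t s *
        bwRow t s k * (if k.root = v then 1 else 0) =
      bwC (fun t t' : STree E => if (t, t') ∈ liftEdges E then x t.root t'.root else 0) t s *
        ((if t.root = v then 1 else 0) - (if s.root = v ∧ s ≠ t then 1 else 0)) := by
    intro s
    simp only [mul_assoc]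
    rw [← Finset.mul_sum]
    congr 1
    simp only [bwRow, sub_mul, Finset.sum_sub_distrib, ite_mul, one_mul, zero_mul]
    congr 1
    · simp
    · by_cases h : s = t <;> simp [h]
  simp only [h1]
  rw [← Finset.sum_filter_of_ne (p := fun s => s = t ∨ STreeEdge E t s)]
  · apply Finset.sum_of_injOn (fun s : STree E => s.root)
    · intro s hs s' hs' hss
      have hss' : s.root = s'.root := hss
      simp only [Finset.coe_filter, Finset.mem_univ, true_and, Set.mem_ofPred_eq] at hs hs'
      rcases hs with rfl | hs
      · rcases hs' with rfl | hs'
        · rfl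
        · exact absurd hss' hs'.1
      · rcases hs' with rfl | hs'
        · exact absurd hss'.symm hs.1
        · apply Subtype.ext
          refine Prod.ext ?_ hss
          have a := hs.2.2
          have b := hs'.2.2
          rw [hss', ← b] at a
          exact a
    · intro s _; simp
    · intro u _ hu
      have hut : u ≠ t.root := by
        rintro rfl
        exact hu ⟨t, by simp, rfl⟩
      have huE : (t.root, u) ∉ E := by
        intro hE
        obtain ⟨t', h1, h2⟩ := bw_step E t u hut.symm hE
        exact hu ⟨t', by simp [h2], h1⟩
      simp [bwC, hut, huE]
    · intro s hs
      simp only [Finset.mem_filter, Finset.mem_univ, true_and] at hs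
      rcases hs with rfl | hs
      · simp [bwC, bwRow, eq_comm]
      · have hne : s ≠ t := by rintro rfl; exact hs.1 rfl
        have hne' : s.root ≠ t.root := hs.1.symm
        have hl : (t, s) ∈ liftEdges E := hs
        simp only [bwC, bwRow, hne, hne', hl, hs.2.1, if_true, if_false, ne_eq, not_false_eq_true,
          and_true, eq_comm]
  · intro s _ hs
    by_contra hcon
    push Not at hcon
    apply hs
    have : (t, s) ∉ liftEdges E := hcon.2
    simp [bwC, hcon.1, this]

end Helpers

/-- in `MvPolynomial (V × V) ℤ`, the spanning tree polynomial `τ(G)` divides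
the spanning tree polynomial `τ(Ḡ)` of the spanning tree graph; i.e. Biane's rational
function `Φ_G` is a polynomial in the edge weights. -/
theorem stmt13 {V : Type*} [Fintype V] [DecidableEq V] [Nonempty V]
    (E : Set (V × V)) (hloop : ∀ v : V, (v, v) ∉ E) (hconn : StronglyConnected E) :
    (∑ t : STree E, ∏ v ∈ Finset.univ.erase t.root,
        (MvPolynomial.X (v, t.tree v) : MvPolynomial (V × V) ℤ)) ∣
      ∑ T : STree (liftEdges E), ∏ t ∈ Finset.univ.erase T.root,
        (MvPolynomial.X (STree.root t, STree.root (T.tree t)) : MvPolynomial (V × V) ℤ) := by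
  classical
  have hsurj : Function.Surjective (fun t : STree E => t.root) := fun r => bw_exists E hconn r
  haveI : Nonempty (STree E) := ⟨(bw_exists E hconn (Classical.arbitrary V)).choose⟩
  let x : V → V → MvPolynomial (V × V) ℤ := fun i j => MvPolynomial.X (i, j)
  obtain ⟨Z, hZ⟩ := bw_det_dvd (fun t : STree E => t.root) hsurj _ _ (bw_lump E x)
  have h1 := bw_coeff_one E x
  have h2 := bw_coeff_one (liftEdges E) (fun t t' : STree E => x t.root t'.root)
  have h0 := bw_coeff_zero (fun v u => if (v, u) ∈ E then x v u else 0)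
  rw [hZ, Polynomial.mul_coeff_one, h0, zero_mul, zero_add, h1] at h2
  refine ⟨Z.coeff 0, ?_⟩
  convert h2.symm using 1
end
end

section
/- Let P be a transition matrix associated with G, P̄ its lift, and L̄ = 1 − P̄ the Laplacian matrix of the lifted chain. Then for every spanning tree t ∈ V̄, τ(G) · det(L̄|_{V̄ ∖ {t}}) = w(t) · τ(Ḡ), where L̄|_{V̄ ∖ {t}} is the matrix L̄ with the row and column corresponding to t removed, w(t) = ∏_{v ≠ root(t)} P v (t v) is the weight of t, τ(G) = ∑_{t' ∈ V̄} w(t'), and τ(Ḡ) is the sum of the weights of the spanning trees of Ḡ with edge weights given by P̄. (That is, det L̄^{(t)} = w(t) · Φ_G.) -/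
open Matrix Finset Classical

noncomputable section

section MTT
variable {U : Type*} [Fintype U] [DecidableEq U]

def elemM (r : U) (f : U → U) : Matrix U U ℝ :=
  fun v => if v = r then Pi.single r 1 else Pi.single v 1 - Pi.single (f v) 1

lemma det_elemM_not (r : U) (f : U → U) (h : ¬ ∀ v, ∃ n, f^[n] v = r) :
    (elemM r f).det = 0 := by
  rw [← Matrix.exists_mulVec_eq_zero_iff]
  push Not at h
  obtain ⟨v₀, hv₀⟩ := h
  refine ⟨fun v => if (∀ n, f^[n] v ≠ r) then 1 else 0, ?_, ?_⟩
  · intro h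
    have := congrFun h v₀
    simp [hv₀] at this
  · funext v
    by_cases hv : v = r
    · subst hv
      have : ¬ ∀ n, f^[n] v ≠ v := fun h => h 0 rfl
      simp only [elemM, Matrix.mulVec, if_true, single_dotProduct, if_neg this]
      simp
    · simp only [elemM, Matrix.mulVec, if_neg hv, sub_dotProduct, single_dotProduct]
      have : (∀ n, f^[n] v ≠ r) ↔ (∀ n, f^[n] (f v) ≠ r) := by
        constructor
        · intro h n
          exact h (n+1)
        · intro h n
          cases n with
          | zero => exact hv
          | succ n => exact h n
      simp [this]

lemma det_elemM_tree (r : U) (f : U → U) (h : ∀ v, ∃ n, f^[n] v = r) :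
    (elemM r f).det = 1 := by
  let b : U → ℕᵒᵈ := fun v => OrderDual.toDual (Nat.find (h v))
  have key : ∀ v, v ≠ r → Nat.find (h (f v)) < Nat.find (h v) := by
    intro v hv
    have h1 := Nat.find_spec (h v)
    generalize Nat.find (h v) = n at h1
    cases n with
    | zero => exact absurd h1 hv
    | succ n => exact Nat.lt_succ_of_le (Nat.find_min' _ h1)
  have hT : (elemM r f).BlockTriangular b := by
    intro i j hij
    have hij' : Nat.find (h i) < Nat.find (h j) := hij
    have hne : j ≠ i := by rintro rfl; exact lt_irrefl _ hij'
    by_cases hi : i = r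
    · subst hi
      simp [elemM, Pi.single_apply, hne]
    · have := key i hi
      have h2 : j ≠ f i := by rintro rfl; omega
      simp [elemM, hi, Pi.single_apply, hne, h2]
  rw [hT.det]
  apply Finset.prod_eq_one
  intro a _
  rw [show (elemM r f).toSquareBlock b a = 1 from ?_, Matrix.det_one]
  ext ⟨i, hi⟩ ⟨j, hj⟩
  have hij : Nat.find (h i) = Nat.find (h j) := hi.trans hj.symm
  by_cases hir : i = r
  · subst hir
    simp [Matrix.toSquareBlock_def, elemM, Matrix.one_apply, Pi.single_apply, eq_comm]
  · have := key i hir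
    have h2 : j ≠ f i := by rintro rfl; omega
    simp [Matrix.toSquareBlock_def, elemM, hir, Matrix.one_apply, Pi.single_apply, h2, @eq_comm _ i j]

lemma mtt_row (Q : Matrix U U ℝ) (hQ : ∀ i, ∑ j, Q i j = 1) (r : U) :
    ((1 - Q).updateRow r (Pi.single r 1)).det
      = ∑ f : U → U, if f r = r ∧ ∀ v, ∃ n, f^[n] v = r
          then ∏ v ∈ Finset.univ.erase r, Q v (f v) else 0 := by
  have h1 : (1 - Q).updateRow r (Pi.single r 1) =
      fun v => ∑ u, (if v = r then (if u = r then (1:ℝ) else 0) else Q v u) •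
        (if v = r then (Pi.single r 1 : U → ℝ) else Pi.single v 1 - Pi.single u 1) := by
    funext v w
    by_cases hv : v = r
    · subst hv
      simp [Finset.sum_apply, ite_apply]
    · rw [Matrix.updateRow_ne hv]
      simp only [hv, if_false, Finset.sum_apply, Pi.smul_apply, Pi.sub_apply, smul_eq_mul, mul_sub,
        Finset.sum_sub_distrib, ← Finset.sum_mul, hQ]
      simp [Pi.single_apply, Matrix.one_apply, eq_comm]
  rw [h1]
  have h2 := (Matrix.detRowAlternating (R := ℝ) (n := U)).toMultilinearMap.map_sum
    (g := fun v u => (if v = r then (if u = r then (1:ℝ) else 0) else Q v u) •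
        (if v = r then (Pi.single r 1 : U → ℝ) else Pi.single v 1 - Pi.single u 1))
  refine h2.trans ?_
  refine Finset.sum_congr rfl fun f _ => ?_
  rw [MultilinearMap.map_smul_univ]
  have h3 : (Matrix.detRowAlternating (R := ℝ) (n := U)).toMultilinearMap
    (fun v => (if v = r then (Pi.single r 1 : U → ℝ) else Pi.single v 1 - Pi.single (f v) 1))
      = (elemM r f).det := rfl
  rw [h3, ← Finset.mul_prod_erase _ _ (Finset.mem_univ r)]
  have h4 : ∏ x ∈ Finset.univ.erase r, (if x = r then (if f x = r then (1:ℝ) else 0) else Q x (f x))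
      = ∏ x ∈ Finset.univ.erase r, Q x (f x) :=
    Finset.prod_congr rfl fun x hx => by simp [Finset.ne_of_mem_erase hx]
  rw [h4]
  by_cases ha : f r = r
  · by_cases hb : ∀ v, ∃ n, f^[n] v = r
    · rw [det_elemM_tree r f hb, if_pos (show f r = r ∧ ∀ v, ∃ n, f^[n] v = r from ⟨ha, hb⟩)]; simp [ha]
    · rw [det_elemM_not r f hb,
        if_neg (show ¬ (f r = r ∧ ∀ v, ∃ n, f^[n] v = r) from fun h => hb h.2)]; simp
  · simp [ha]

lemma mtt_sum (F : Set (U × U)) (Q : Matrix U U ℝ) (hQ : ∀ i, ∑ j, Q i j = 1)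
    (hF : ∀ i j, i ≠ j → (i, j) ∉ F → Q i j = 0) :
    ∑ r, ((1 - Q).updateRow r (Pi.single r 1)).det
      = ∑ T : STree F, ∏ u ∈ Finset.univ.erase T.root, Q u (T.tree u) := by
  simp_rw [mtt_row Q hQ]
  rw [Finset.sum_comm, ← Fintype.sum_prod_type'
    (f := fun (f : U → U) (r : U) => if f r = r ∧ ∀ v, ∃ n, f^[n] v = r
          then ∏ v ∈ Finset.univ.erase r, Q v (f v) else 0)]
  have h1 : ∀ p : (U → U) × U, (if p.1 p.2 = p.2 ∧ ∀ v, ∃ n, p.1^[n] v = p.2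
          then ∏ v ∈ Finset.univ.erase p.2, Q v (p.1 v) else 0) =
        if IsSpanningTree F p.2 p.1 then ∏ v ∈ Finset.univ.erase p.2, Q v (p.1 v) else 0 := by
    rintro ⟨f, r⟩
    by_cases hs : IsSpanningTree F r f
    · rw [if_pos hs, if_pos ⟨hs.1, hs.2.2⟩]
    · rw [if_neg hs]
      split_ifs with h
      · obtain ⟨ha, hb⟩ := h
        have : ∃ v, v ≠ r ∧ (v, f v) ∉ F := by
          by_contra! hc
          exact hs ⟨ha, hc, hb⟩
        obtain ⟨v, hv, hvF⟩ := this
        refine Finset.prod_eq_zero (Finset.mem_erase.2 ⟨hv, Finset.mem_univ v⟩) (hF _ _ ?_ hvF)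
        intro hfix
        obtain ⟨n, hn⟩ := hb v
        exact hv ((Function.iterate_fixed hfix.symm n).symm.trans hn)
      · rfl
  simp_rw [h1]
  rw [← Finset.sum_filter]
  symm
  refine Finset.sum_bij (fun T _ => T.1) ?_ ?_ ?_ ?_
  · intro T _; simpa using T.2
  · intro a _ b _ h; exact Subtype.ext h
  · intro p hp; exact ⟨⟨p, by simpa using hp⟩, Finset.mem_univ _, rfl⟩
  · intro T _; rfl

lemma kerRow (A : Matrix U U ℝ) (w : U → ℝ) (hw : w ᵥ* A = 0) (i j : U) (x : U → ℝ) :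
    w i * (A.updateRow j x).det = w j * (A.updateRow i x).det := by
  by_cases hij : i = j
  · subst hij; rfl
  set B := A.updateRow j x with hB
  have h1 : w ᵥ* B = w j • (x - A j) := by
    have : B = A + Matrix.of (Pi.single j (x - A j)) := by
      ext a b
      by_cases ha : a = j
      · subst ha; simp [hB]
      · simp [hB, ha]
    rw [this, Matrix.vecMul_add, hw, zero_add]
    ext b
    simp only [Matrix.vecMul, dotProduct, Matrix.of_apply]
    rw [Finset.sum_eq_single j]
    · simp
    · intro a _ ha; simp [ha]
    · simp
  have h2 : w i * B.det = w j * (B.updateRow i (x - A j)).det := by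
    rw [← Matrix.det_updateRow_smul B i, ← h1]
    have := Matrix.det_updateRow_sum B i w
    rw [smul_eq_mul] at this
    rw [← this]
    congr 2
    ext b
    simp [Matrix.vecMul, dotProduct]
  rw [h2]
  congr 1
  have e1 : x - A j = x + (-1 : ℝ) • A j := by simp [sub_eq_add_neg]
  rw [e1, Matrix.det_updateRow_add, Matrix.det_updateRow_smul]
  have e2 : (B.updateRow i x).det = 0 := by
    have : x = B j := by simp [hB]
    rw [this]
    exact Matrix.det_updateRow_eq_zero (Ne.symm hij)
  have e3 : B.updateRow i (A j) = (A.updateRow i x).submatrix (Equiv.swap i j) id := by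
    ext a b
    by_cases ha : a = i
    · subst ha; simp [Matrix.updateRow_ne (Ne.symm hij)]
    · by_cases hb : a = j
      · subst hb; simp [hB, Matrix.updateRow_ne ha]
      · simp [hB, ha, hb, Equiv.swap_apply_of_ne_of_ne ha hb]
  rw [e2, e3, Matrix.det_permute, Equiv.Perm.sign_swap hij]
  simp

lemma cof_eq (A : Matrix U U ℝ) (w : U → ℝ) (hw : w ᵥ* A = 0) (h1 : A *ᵥ 1 = 0) (i j : U) :
    w i * (A.updateRow j (Pi.single j 1)).det = w j * (A.updateRow i (Pi.single i 1)).det := by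
  rw [kerRow A w hw i j]
  congr 1
  rw [← Matrix.adjugate_apply, ← Matrix.adjugate_apply]
  have h2 : (1 : U → ℝ) ᵥ* Aᵀ = 0 := by rw [Matrix.vecMul_transpose, h1]
  have := kerRow Aᵀ 1 h2 i j (Pi.single i 1)
  simp only [Pi.one_apply, one_mul] at this
  rw [← Matrix.adjugate_apply, ← Matrix.adjugate_apply, ← Matrix.adjugate_transpose] at this
  simpa using this

lemma det_sub_eq (A : Matrix U U ℝ) (t : U) :
    (A.submatrix (fun u : {u : U // u ≠ t} => u.1) (fun u : {u : U // u ≠ t} => u.1)).det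
      = (A.updateRow t (Pi.single t 1)).det := by
  rw [Matrix.twoBlockTriangular_det' (A.updateRow t (Pi.single t 1)) (fun u => u = t)]
  · have h1 : Matrix.toSquareBlockProp (A.updateRow t (Pi.single t 1)) (fun u => u = t) = 1 := by
      ext ⟨i, hi⟩ ⟨j, hj⟩
      subst hi; subst hj
      simp [Matrix.toSquareBlockProp_def]
    rw [h1, @Matrix.det_one _ _ (_) _ _, one_mul]
    congr 1
    ext ⟨i, hi⟩ ⟨j, hj⟩
    simp [Matrix.toSquareBlockProp_def, Matrix.updateRow_ne hi]
  · intro i hi j hj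
    subst hi
    simp [hj]
end MTT
section Lift
variable {V : Type*} [DecidableEq V]

/-- moving the root forwards gives a spanning tree -/
lemma step_tree (E : Set (V × V)) (f : V → V) (i j : V) (h : IsSpanningTree E i f) (hij : i ≠ j)
    (hE : (i, j) ∈ E) : IsSpanningTree E j (Function.update (Function.update f i j) j j) := by
  set g := Function.update (Function.update f i j) j j with hg
  have gj : g j = j := by simp [hg]
  have gi : g i = j := by simp [hg, hij]
  have go : ∀ v, v ≠ i → v ≠ j → g v = f v := by intro v h1 h2; simp [hg, h1, h2]
  refine ⟨gj, ?_, ?_⟩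
  · intro v hv
    by_cases hvi : v = i
    · subst hvi; rwa [gi]
    · rw [go v hvi hv]; exact h.2.1 v hvi
  · intro v
    obtain ⟨n, hn⟩ := h.2.2 v
    induction n generalizing v with
    | zero => exact ⟨1, by rw [show v = i from hn]; exact gi⟩
    | succ n ih =>
      by_cases h1 : v = i
      · exact ⟨1, by rw [h1]; exact gi⟩
      by_cases h2 : v = j
      · exact ⟨0, h2⟩
      obtain ⟨m, hm⟩ := ih (f v) hn
      exact ⟨m + 1, by rw [Function.iterate_succ_apply, go v h1 h2, hm]⟩

/-- moving the root backwards -/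
lemma back_tree (E : Set (V × V)) (g : V → V) (j k : V) (h : IsSpanningTree E j g) (hjk : k ≠ j)
    (hE : (j, k) ∈ E) : ∃ i, i ≠ j ∧ g i = j ∧
      IsSpanningTree E i (Function.update (Function.update g j k) i i) := by
  have hk := Nat.find_spec (h.2.2 k)
  have hmin : ∀ m, m < Nat.find (h.2.2 k) → g^[m] k ≠ j := fun m hm => Nat.find_min (h.2.2 k) hm
  generalize Nat.find (h.2.2 k) = N at hk hmin
  cases N with
  | zero => exact absurd hk hjk
  | succ n =>
  set i := g^[n] k with hi
  have hij : i ≠ j := hmin n (Nat.lt_succ_self n)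
  have hgi : g i = j := by rw [hi, ← Function.iterate_succ_apply' g]; exact hk
  refine ⟨i, hij, hgi, ?_⟩
  set f := Function.update (Function.update g j k) i i with hf
  have fi : f i = i := by simp [hf]
  have fj : f j = k := by simp [hf, hij.symm]
  have fo : ∀ v, v ≠ i → v ≠ j → f v = g v := by intro v h1 h2; simp [hf, h1, h2]
  have hk' : f^[n] k = i := by
    have : ∀ m, m ≤ n → f^[m] k = g^[m] k := by
      intro m hm
      induction m with
      | zero => rfl
      | succ m ih =>
        rw [Function.iterate_succ_apply', ih (by omega), Function.iterate_succ_apply']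
        apply fo
        · intro h1
          apply hmin (m+1) (by omega)
          rw [Function.iterate_succ_apply', h1, hgi]
        · exact hmin m (by omega)
    exact this n le_rfl
  have hj' : f^[n+1] j = i := by rw [Function.iterate_succ_apply, fj, hk']
  refine ⟨fi, ?_, ?_⟩
  · intro v hv
    by_cases hvj : v = j
    · rw [hvj, fj]; exact hE
    · rw [fo v hv hvj]; exact h.2.1 v hvj
  · intro v
    obtain ⟨m, hm⟩ := h.2.2 v
    induction m generalizing v with
    | zero => exact ⟨n+1, by rw [show v = j from hm]; exact hj'⟩
    | succ m ih =>
      by_cases h1 : v = i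
      · exact ⟨0, h1⟩
      by_cases h2 : v = j
      · exact ⟨n+1, by rw [h2]; exact hj'⟩
      obtain ⟨m', hm'⟩ := ih (g v) hm
      exact ⟨m' + 1, by rw [Function.iterate_succ_apply, fo v h1 h2, hm']⟩

lemma tree_no_return (E : Set (V × V)) (f : V → V) (i j : V) (h : IsSpanningTree E i f)
    (hij : j ≠ i) (m : ℕ) : f^[m+1] j ≠ j := by
  intro hm
  obtain ⟨N, hN⟩ := h.2.2 j
  have h1 : f^[(m+1) * N] j = j := by
    rw [Function.iterate_mul]; exact Function.iterate_fixed hm N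
  have h2 : f^[(m+1) * N] j = i := by
    rw [show (m+1) * N = m * N + N by ring, Function.iterate_add_apply, hN]
    exact Function.iterate_fixed h.1 _
  exact hij (h1.symm.trans h2)

lemma root_orbit (E : Set (V × V)) (f g : V → V) (i j : V) (h : IsSpanningTree E i f) (hij : i ≠ j)
    (hg : g = Function.update (Function.update f i j) j j) : ∃ n, g^[n] (f j) = i := by
  have hk := Nat.find_spec (h.2.2 (f j))
  have hmin : ∀ m, m < Nat.find (h.2.2 (f j)) → f^[m] (f j) ≠ i :=
    fun m hm => Nat.find_min (h.2.2 (f j)) hm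
  generalize Nat.find (h.2.2 (f j)) = n at hk hmin
  refine ⟨n, ?_⟩
  have go : ∀ v, v ≠ i → v ≠ j → g v = f v := by intro v h1 h2; simp [hg, h1, h2]
  have : ∀ m, m ≤ n → g^[m] (f j) = f^[m] (f j) := by
    intro m hm
    induction m with
    | zero => rfl
    | succ m ih =>
      rw [Function.iterate_succ_apply', ih (by omega), Function.iterate_succ_apply']
      apply go
      · exact hmin m (by omega)
      · exact tree_no_return E f i j h hij.symm m
  rw [this n le_rfl, hk]

lemma orbit_unique (g : V → V) (j k : V) (gj : g j = j) (n₁ n₂ : ℕ)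
    (h1 : g (g^[n₁] k) = j) (h2' : g^[n₂] k ≠ j) : n₂ ≤ n₁ := by
  by_contra! hc
  apply h2'
  rw [show n₂ = (n₂ - n₁ - 1) + (n₁ + 1) by omega, Function.iterate_add_apply,
    Function.iterate_succ_apply', h1]
  exact Function.iterate_fixed gj _

lemma pred_unique {E : Set (V × V)} (a b t : STree E) (ha : STreeEdge E a t) (hb : STreeEdge E b t)
    (hab : a.tree t.root = b.tree t.root) : a = b := by
  obtain ⟨a1, _, a3⟩ := ha
  obtain ⟨b1, _, b3⟩ := hb
  have hta : t.tree a.root = t.root := by rw [a3]; simp [a1]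
  have htb : t.tree b.root = t.root := by rw [b3]; simp [b1]
  obtain ⟨n, hn⟩ := root_orbit E a.tree t.tree a.root t.root a.2 a1 a3
  obtain ⟨m, hm⟩ := root_orbit E b.tree t.tree b.root t.root b.2 b1 b3
  rw [← hab] at hm
  have hnm : n = m := by
    apply le_antisymm
    · exact orbit_unique t.tree t.root (a.tree t.root) t.2.1 m n (by rw [hm, htb]) (by rw [hn]; exact a1)
    · exact orbit_unique t.tree t.root (a.tree t.root) t.2.1 n m (by rw [hn, hta]) (by rw [hm]; exact b1)
  have hr : a.root = b.root := by rw [← hn, ← hm, hnm]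
  have ht : a.tree = b.tree := by
    funext v
    by_cases h1 : v = t.root
    · rw [h1, hab]
    by_cases h2 : v = a.root
    · rw [h2]
      have e1 : a.tree a.root = a.root := a.2.1
      have e2 : b.tree b.root = b.root := b.2.1
      rw [e1, hr, e2]
    · have e1 := congrFun a3 v
      have e2 := congrFun b3 v
      rw [Function.update_of_ne h1, Function.update_of_ne h2] at e1
      rw [Function.update_of_ne h1, Function.update_of_ne (by rwa [← hr])] at e2
      rw [← e1, e2]
  exact Subtype.ext (Prod.ext ht hr)

lemma liftP_eq (E : Set (V × V)) (P : Matrix V V ℝ) (t t' : STree E) :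
    liftP E P t t' = (if t = t' then P t.root t.root else 0)
      + if STreeEdge E t t' then P t.root t'.root else 0 := by
  unfold liftP
  by_cases h : t = t'
  · have : ¬ STreeEdge E t t' := by rintro ⟨h1, _⟩; exact h1 (by rw [h])
    rw [if_pos h, if_pos h, if_neg this, add_zero]
  · rw [if_neg h, if_neg h, zero_add]

variable [Fintype V]

lemma off_sum (E : Set (V × V)) (hloop : ∀ v : V, (v, v) ∉ E) (P : Matrix V V ℝ)
    (hP : IsTransMatrix E P) (i : V) :
    P i i + ∑ k ∈ Finset.univ.filter (fun k => (i, k) ∈ E), P i k = 1 := by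
  rw [← hP.2.1 i, ← Finset.add_sum_erase _ _ (Finset.mem_univ i)]
  congr 1
  apply Finset.sum_subset
  · intro k hk
    simp only [Finset.mem_filter, Finset.mem_univ, true_and] at hk
    simp only [Finset.mem_erase, Finset.mem_univ, and_true]
    rintro rfl
    exact hloop _ hk
  · intro k hk hk2
    simp only [Finset.mem_filter, Finset.mem_univ, true_and] at hk2
    simp only [Finset.mem_erase, Finset.mem_univ, and_true] at hk
    have := mt (hP.2.2 i k (Ne.symm hk)).1 hk2
    exact le_antisymm (not_lt.1 this) (hP.1 i k)

lemma lift_row_sum (E : Set (V × V)) (hloop : ∀ v : V, (v, v) ∉ E) (P : Matrix V V ℝ)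
    (hP : IsTransMatrix E P) (t : STree E) : ∑ t', liftP E P t t' = 1 := by
  simp_rw [liftP_eq]
  rw [Finset.sum_add_distrib, ← Finset.sum_filter (fun x : STree E => STreeEdge E t x)]
  refine (congrArg₂ (· + ·) (?_ : _ = P t.root t.root) ?_).trans (off_sum E hloop P hP t.root)
  · refine (Finset.sum_eq_single t ?_ ?_).trans (if_pos rfl)
    · intro b _ hb; exact if_neg hb.symm
    · intro h; exact absurd (Finset.mem_univ t) h
  refine Finset.sum_bij (fun s _ => s.root) ?_ ?_ ?_ ?_
  · intro s hs
    simp only [Finset.mem_filter, Finset.mem_univ, true_and] at hs ⊢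
    exact hs.2.1
  · intro a ha b hb hab
    simp only [Finset.mem_filter, Finset.mem_univ, true_and] at ha hb
    refine Subtype.ext (Prod.ext ?_ hab)
    have h1 := ha.2.2
    have h2 := hb.2.2
    have hab' : a.root = b.root := hab
    rw [hab', ← h2] at h1
    exact h1
  · intro k hk
    simp only [Finset.mem_filter, Finset.mem_univ, true_and] at hk
    have hne : t.root ≠ k := by rintro h; rw [h] at hk; exact hloop _ hk
    refine ⟨⟨(_, k), step_tree E t.tree t.root k t.2 hne hk⟩, ?_, rfl⟩
    simp only [Finset.mem_filter, Finset.mem_univ, true_and]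
    exact ⟨hne, hk, rfl⟩
  · intro s _; rfl

lemma weight_edge {E : Set (V × V)} (P : Matrix V V ℝ) (s t : STree E) (h : STreeEdge E s t) :
    (∏ v ∈ Finset.univ.erase s.root, P v (s.tree v)) * P s.root t.root
      = (∏ v ∈ Finset.univ.erase t.root, P v (t.tree v)) * P t.root (s.tree t.root) := by
  obtain ⟨h1, _, h3⟩ := h
  have hts : t.tree s.root = t.root := by rw [h3]; simp [h1]
  rw [← Finset.mul_prod_erase (Finset.univ.erase s.root) _
      (Finset.mem_erase.2 ⟨h1.symm, Finset.mem_univ t.root⟩),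
    ← Finset.mul_prod_erase (Finset.univ.erase t.root) _
      (Finset.mem_erase.2 ⟨h1, Finset.mem_univ s.root⟩), hts, Finset.erase_right_comm]
  have : ∏ x ∈ (Finset.univ.erase t.root).erase s.root, P x (s.tree x)
      = ∏ x ∈ (Finset.univ.erase t.root).erase s.root, P x (t.tree x) := by
    refine Finset.prod_congr rfl fun x hx => ?_
    simp only [Finset.mem_erase, Finset.mem_univ, and_true] at hx
    rw [h3, Function.update_of_ne hx.2, Function.update_of_ne hx.1]
  rw [this]
  ring

lemma lift_balance (E : Set (V × V)) (hloop : ∀ v : V, (v, v) ∉ E) (P : Matrix V V ℝ)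
    (hP : IsTransMatrix E P) (t : STree E) :
    ∑ s : STree E, (∏ v ∈ Finset.univ.erase s.root, P v (s.tree v)) * liftP E P s t
      = ∏ v ∈ Finset.univ.erase t.root, P v (t.tree v) := by
  simp_rw [liftP_eq, mul_add, mul_ite, mul_zero]
  rw [Finset.sum_add_distrib, Finset.sum_ite_eq', if_pos (Finset.mem_univ _), ← Finset.sum_filter]
  conv_rhs => rw [← mul_one (∏ v ∈ Finset.univ.erase t.root, P v (t.tree v)),
    ← off_sum E hloop P hP t.root, mul_add, Finset.mul_sum]
  congr 1
  refine Finset.sum_bij (fun s _ => s.tree t.root) ?_ ?_ ?_ ?_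
  · intro s hs
    simp only [Finset.mem_filter, Finset.mem_univ, true_and] at hs ⊢
    exact s.2.2.1 _ hs.1.symm
  · intro a ha b hb hab
    simp only [Finset.mem_filter, Finset.mem_univ, true_and] at ha hb
    exact pred_unique a b t ha hb hab
  · intro k hk
    simp only [Finset.mem_filter, Finset.mem_univ, true_and] at hk
    have hne : k ≠ t.root := by rintro h; rw [h] at hk; exact hloop _ hk
    obtain ⟨i, hi, hti, hT⟩ := back_tree E t.tree t.root k t.2 hne hk
    refine ⟨⟨(_, i), hT⟩, ?_, ?_⟩
    · simp only [Finset.mem_filter, Finset.mem_univ, true_and]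
      have hiE : (i, t.root) ∈ E := by
        have := t.2.2.1 i hi
        rwa [show t.1.1 i = t.root from hti] at this
      refine ⟨hi, hiE, ?_⟩
      funext v
      have e1 : t.tree t.root = t.root := t.2.1
      change t.tree v = Function.update (Function.update (Function.update
        (Function.update t.tree t.root k) i i) i t.root) t.root t.root v
      by_cases h1 : v = t.root
      · rw [h1, e1]; simp
      by_cases h2 : v = i
      · rw [h2, hti]; simp [hi]
      · simp [h1, h2]
    · change Function.update (Function.update t.tree t.root k) i i t.root = k
      simp [hi.symm]
  · intro s hs
    simp only [Finset.mem_filter, Finset.mem_univ, true_and] at hs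
    exact weight_edge P s t hs

end Lift

/-- for every spanning tree `t ∈ V̄`, `det L̄^{(t)} = w(t) · Φ_G`, i.e.
`τ(G) · det L̄^{(t)} = w(t) · τ(Ḡ)`, where `L̄ = I - P̄` and `L̄^{(t)}` has the row and
column of `t` removed. -/
theorem stmt14 {V : Type*} [Fintype V] [DecidableEq V] [Nonempty V]
    (E : Set (V × V)) (hloop : ∀ v : V, (v, v) ∉ E) (hconn : StronglyConnected E)
    (P : Matrix V V ℝ) (hP : IsTransMatrix E P)
    (t : STree E) :
    (∑ t' : STree E, ∏ v ∈ Finset.univ.erase t'.root, P v (t'.tree v)) *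
      Matrix.det ((1 - liftP E P).submatrix
        (fun u : {u : STree E // u ≠ t} => u.1) (fun u : {u : STree E // u ≠ t} => u.1))
    = (∏ v ∈ Finset.univ.erase t.root, P v (t.tree v)) *
      ∑ T : STree (liftEdges E), ∏ u ∈ Finset.univ.erase T.root, liftP E P u (T.tree u) := by
  have hrow := lift_row_sum E hloop P hP
  have hmtt := mtt_sum (liftEdges E) (liftP E P) hrow (by
    intro a b hab hF
    unfold liftP
    rw [if_neg hab, if_neg (show ¬ STreeEdge E a b from hF)])
  have hsub := det_sub_eq (1 - liftP E P) t
  have hcof : ∀ s, (∏ v ∈ Finset.univ.erase s.root, P v (s.tree v)) *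
      ((1 - liftP E P).updateRow t (Pi.single t 1)).det =
      (∏ v ∈ Finset.univ.erase t.root, P v (t.tree v)) *
      ((1 - liftP E P).updateRow s (Pi.single s 1)).det := by
    intro s
    refine cof_eq (1 - liftP E P)
      (fun s : STree E => ∏ v ∈ Finset.univ.erase s.root, P v (s.tree v)) ?_ ?_ s t
    · funext u
      rw [Matrix.vecMul_sub, Matrix.vecMul_one, Pi.sub_apply]
      exact sub_eq_zero.2 (lift_balance E hloop P hP u).symm
    · funext u
      rw [Matrix.sub_mulVec, Matrix.one_mulVec, Pi.sub_apply]
      simp [Matrix.mulVec, dotProduct, hrow]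
  have hfin := Finset.sum_congr (rfl : (Finset.univ : Finset (STree E)) = Finset.univ)
    (fun s _ => hcof s)
  rw [← Finset.sum_mul, ← Finset.mul_sum, hmtt, ← hsub] at hfin
  convert hfin using 2
end
end

section
/- Let P be a transition matrix associated with G and P̄ its lift to the spanning tree graph. Then the spanning-tree weights form an invariant measure for the lifted chain: for every t' ∈ V̄, ∑_{t ∈ V̄} w(t) · P̄ t t' = w(t'), where w(t) = ∏_{v ≠ root(t)} P v (t v). -/
open Matrix Finset Classical

noncomputable section

theorem aux_exists {V : Type*} (f : V → V) (r : V) : ∀ (n : ℕ) (x : V), x ≠ r → f^[n] x = r →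
    ∃ i, i ≠ r ∧ f i = r ∧ ∀ g : V → V, (∀ v, v ≠ r → v ≠ i → g v = f v) → ∃ m, g^[m] x = i := by
  intro n
  induction n with
  | zero => intro x hx h; exact absurd h hx
  | succ n ih =>
    intro x hx h
    by_cases hf : f x = r
    · exact ⟨x, hx, hf, fun g _ => ⟨0, rfl⟩⟩
    · obtain ⟨i, hi, hfi, H⟩ := ih (f x) hf h
      refine ⟨i, hi, hfi, fun g hg => ?_⟩
      by_cases hxi : x = i
      · exact ⟨0, hxi⟩
      · obtain ⟨m, hm⟩ := H g hg
        refine ⟨m + 1, ?_⟩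
        rw [Function.iterate_succ_apply, hg x hx hxi, hm]

theorem aux_avoid {V : Type*} (f t : V → V) (r i : V) (hir : i ≠ r)
    (ht : ∀ v, v ≠ r → v ≠ i → t v = f v) : ∀ (n : ℕ) (v : V), t^[n] v = i →
    (∃ m, f^[m] v = i ∧ ∀ j ≤ m, f^[j] v ≠ r) ∨
      (∃ m, f^[m] (t r) = i ∧ ∀ j ≤ m, f^[j] (t r) ≠ r) := by
  have triv : ∃ m, f^[m] i = i ∧ ∀ j ≤ m, f^[j] i ≠ r :=
    ⟨0, rfl, fun j hj => by obtain rfl : j = 0 := by omega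
                            exact hir⟩
  intro n
  induction n with
  | zero => intro v h; left; obtain rfl : v = i := h; exact triv
  | succ n ih =>
    intro v h
    by_cases hvi : v = i
    · subst hvi; exact Or.inl triv
    by_cases hvr : v = r
    · subst hvr
      right
      rcases ih _ h with h | h <;> exact h
    rw [Function.iterate_succ_apply, ht v hvr hvi] at h
    rcases ih _ h with ⟨m, hm, hj⟩ | h
    · left
      refine ⟨m + 1, hm, fun j hj' => ?_⟩
      cases j with
      | zero => exact hvr
      | succ j => exact hj j (by omega)
    · exact Or.inr h

theorem aux_unique {V : Type*} (f : V → V) (r x i₁ i₂ : V) (h1 : f i₁ = r) (h2 : f i₂ = r)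
    (a1 : ∃ m, f^[m] x = i₁ ∧ ∀ j ≤ m, f^[j] x ≠ r)
    (a2 : ∃ m, f^[m] x = i₂ ∧ ∀ j ≤ m, f^[j] x ≠ r) : i₁ = i₂ := by
  obtain ⟨m, hm, hj⟩ := a1
  obtain ⟨n, hn, hk⟩ := a2
  rcases lt_trichotomy m n with h | h | h
  · exact absurd (by rw [Function.iterate_succ_apply', hm, h1]) (hk (m + 1) h)
  · subst h; rw [← hm, hn]
  · exact absurd (by rw [Function.iterate_succ_apply', hn, h2]) (hj (n + 1) h)

theorem aux_edge {V : Type*} [DecidableEq V] {E : Set (V × V)} {t t' : STree E}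
    (h : STreeEdge E t t') : t'.tree t.root = t'.root ∧
      ∀ v, v ≠ t'.root → v ≠ t.root → t.tree v = t'.tree v := by
  obtain ⟨h1, h2, h3⟩ := h
  rw [h3]
  refine ⟨by simp [Function.update, h1], fun v hv hv' => by simp [Function.update, hv, hv']⟩

theorem aux_inj {V : Type*} [DecidableEq V] {E : Set (V × V)} {t₁ t₂ t' : STree E}
    (h1 : STreeEdge E t₁ t') (h2 : STreeEdge E t₂ t') (h : t₁.tree t'.root = t₂.tree t'.root) :
    t₁ = t₂ := by
  obtain ⟨a1, b1⟩ := aux_edge h1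
  obtain ⟨a2, b2⟩ := aux_edge h2
  have key : ∀ t : STree E, STreeEdge E t t' →
      ∃ m, t'.tree^[m] (t.tree t'.root) = t.root ∧
        ∀ j ≤ m, t'.tree^[j] (t.tree t'.root) ≠ t'.root := by
    intro t ht
    obtain ⟨n, hn⟩ := t.2.2.2 (t.tree t'.root)
    rcases aux_avoid t'.tree t.tree t'.root t.root ht.1 (aux_edge ht).2 n _ hn with h | h <;> exact h
  have hr : t₁.root = t₂.root :=
    aux_unique t'.tree t'.root (t₁.tree t'.root) _ _ a1 a2 (key t₁ h1) (h ▸ key t₂ h2)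
  have e1 : t₁.tree t₁.root = t₁.root := t₁.2.1
  have e2 : t₂.tree t₂.root = t₂.root := t₂.2.1
  refine Subtype.ext (Prod.ext (funext fun v => ?_) hr)
  change t₁.tree v = t₂.tree v
  by_cases hv : v = t'.root
  · rw [hv, h]
  by_cases hv' : v = t₁.root
  · rw [hv', e1, hr, e2]
  · rw [b1 v hv hv', b2 v hv (hr ▸ hv')]

theorem aux_surj {V : Type*} [DecidableEq V] {E : Set (V × V)} (hloop : ∀ v : V, (v, v) ∉ E)
    (t' : STree E) (k : V) (hk : (t'.root, k) ∈ E) :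
    ∃ t : STree E, STreeEdge E t t' ∧ t.tree t'.root = k := by
  have hkr : k ≠ t'.root := by rintro rfl; exact hloop _ hk
  obtain ⟨f1, f2, f3⟩ : IsSpanningTree E t'.root t'.tree := t'.2
  obtain ⟨n, hn⟩ := f3 k
  obtain ⟨i, hi, hfi, H⟩ := aux_exists _ _ n k hkr hn
  set f := t'.tree with hf
  set r := t'.root with hr
  let g : V → V := Function.update (Function.update f r k) i i
  have gi : g i = i := by simp [g]
  have gr : g r = k := by simp [g, Function.update, hi.symm]
  have gv : ∀ v, v ≠ r → v ≠ i → g v = f v := fun v h h' => by simp [g, Function.update, h, h']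
  obtain ⟨m, hm⟩ := H g gv
  have hT : IsSpanningTree E i g := by
    refine ⟨gi, fun v hv => ?_, ?_⟩
    · by_cases h : v = r
      · rw [h, gr]; exact hk
      · rw [gv v h hv]; exact f2 v h
    · have rr : ∃ n, g^[n] r = i := ⟨m + 1, by rw [Function.iterate_succ_apply, gr, hm]⟩
      have : ∀ n v, f^[n] v = r → ∃ n, g^[n] v = i := by
        intro n
        induction n with
        | zero => intro v h; obtain rfl : v = r := h; exact rr
        | succ n ih =>
          intro v h
          by_cases h1 : v = r
          · rw [h1]; exact rr
          by_cases h2 : v = i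
          · exact ⟨0, h2⟩
          obtain ⟨q, hq⟩ := ih _ h
          exact ⟨q + 1, by rw [Function.iterate_succ_apply, gv v h1 h2, hq]⟩
      intro v
      obtain ⟨n, hn⟩ := f3 v
      exact this n v hn
  refine ⟨⟨(g, i), hT⟩, ⟨hi, ?_, ?_⟩, gr⟩
  · change (i, r) ∈ E
    rw [← hfi]; exact f2 i hi
  · change f = Function.update (Function.update g i r) r r
    funext v
    by_cases h1 : v = r
    · subst h1; simp [f1]
    by_cases h2 : v = i
    · rw [h2]; simp [Function.update, hi, hfi]
    · simp [Function.update, h1, h2, gv]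

/-- the spanning tree weights `w(t) = ∏_{v ≠ root t} P v (t v)` form an
invariant measure for the lifted chain `P̄`. -/
theorem stmt15 {V : Type*} [Fintype V] [DecidableEq V] [Nonempty V]
    (E : Set (V × V)) (hloop : ∀ v : V, (v, v) ∉ E) (hconn : StronglyConnected E)
    (P : Matrix V V ℝ) (hP : IsTransMatrix E P) :
    ∀ t' : STree E,
      (∑ t : STree E, (∏ v ∈ Finset.univ.erase t.root, P v (t.tree v)) * liftP E P t t')
        = ∏ v ∈ Finset.univ.erase t'.root, P v (t'.tree v) := by
  intro t'
  obtain ⟨hP0, hP1, hP2⟩ := hP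
  have hw : ∀ t : STree E, STreeEdge E t t' →
      (∏ v ∈ Finset.univ.erase t.root, P v (t.tree v)) * P t.root t'.root
        = P t'.root (t.tree t'.root) * ∏ v ∈ Finset.univ.erase t'.root, P v (t'.tree v) := by
    intro t ht
    obtain ⟨a, b⟩ := aux_edge ht
    rw [← Finset.mul_prod_erase (Finset.univ.erase t.root) _
        (Finset.mem_erase.2 ⟨ht.1.symm, Finset.mem_univ t'.root⟩),
      ← Finset.mul_prod_erase (Finset.univ.erase t'.root) _
        (Finset.mem_erase.2 ⟨ht.1, Finset.mem_univ t.root⟩), a, Finset.erase_right_comm]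
    have : ∏ v ∈ (Finset.univ.erase t'.root).erase t.root, P v (t.tree v)
        = ∏ v ∈ (Finset.univ.erase t'.root).erase t.root, P v (t'.tree v) := by
      refine Finset.prod_congr rfl fun v hv => ?_
      simp only [Finset.mem_erase, Finset.mem_univ, and_true] at hv
      rw [b v hv.2 hv.1]
    rw [this]; ring
  have hsum : ∑ t ∈ Finset.univ.filter (fun t : STree E => STreeEdge E t t'),
      P t'.root (t.tree t'.root) = ∑ k ∈ Finset.univ.erase t'.root, P t'.root k := by
    have : ∑ k ∈ Finset.univ.erase t'.root, P t'.root k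
        = ∑ k ∈ Finset.univ.filter (fun k => (t'.root, k) ∈ E), P t'.root k := by
      symm
      refine Finset.sum_subset (fun k hk => ?_) (fun k hk hk' => ?_)
      · simp only [Finset.mem_filter, Finset.mem_univ, true_and] at hk
        refine Finset.mem_erase.2 ⟨?_, Finset.mem_univ _⟩
        rintro rfl
        exact hloop _ hk
      · simp only [Finset.mem_filter, Finset.mem_univ, true_and] at hk'
        rw [← hP2 _ _ (Finset.ne_of_mem_erase hk).symm, not_lt] at hk'
        exact le_antisymm hk' (hP0 _ _)
    rw [this]
    refine Finset.sum_bij (fun t _ => t.tree t'.root) ?_ ?_ ?_ ?_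
    · intro t ht
      have ht := (Finset.mem_filter.1 ht).2
      exact Finset.mem_filter.2 ⟨Finset.mem_univ _, t.2.2.1 _ ht.1.symm⟩
    · intro t1 h1 t2 h2 h
      exact aux_inj (Finset.mem_filter.1 h1).2 (Finset.mem_filter.1 h2).2 h
    · intro k hk
      obtain ⟨t, ht, h⟩ := aux_surj hloop t' k (Finset.mem_filter.1 hk).2
      exact ⟨t, Finset.mem_filter.2 ⟨Finset.mem_univ _, ht⟩, h⟩
    · intros; rfl
  set w' := ∏ v ∈ Finset.univ.erase t'.root, P v (t'.tree v) with hw'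
  have hterm : ∀ t : STree E,
      (∏ v ∈ Finset.univ.erase t.root, P v (t.tree v)) * liftP E P t t'
      = (if t = t' then P t'.root t'.root * w' else 0)
        + (if STreeEdge E t t' then P t'.root (t.tree t'.root) * w' else 0) := by
    intro t
    unfold liftP
    by_cases h : t = t'
    · subst h
      have : ¬ STreeEdge E t t := fun h => h.1 rfl
      simp only [if_true, if_neg this, ← hw']; ring
    · by_cases h2 : STreeEdge E t t'
      · simp only [if_neg h, if_pos h2, hw t h2, zero_add]
      · simp only [if_neg h, if_neg h2, mul_zero, zero_add]
  rw [Finset.sum_congr rfl fun t _ => hterm t, Finset.sum_add_distrib, Finset.sum_ite_eq',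
    if_pos (Finset.mem_univ _), ← Finset.sum_filter, ← Finset.sum_mul, hsum, ← add_mul,
    Finset.add_sum_erase _ _ (Finset.mem_univ _), hP1, one_mul]
end
end
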